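/- arXiv:1004.5304 — 3 statements merged into one kernel-verified Lean document; each statement's English description precedes it below -/
import Mathlib

section
/- Let n ≥ 2, s ∈ (0,1] and p ∈ (n/(n+s), n/s). If Ω ⊆ ℝⁿ is a bounded Ṁ^{s,p}_ball-extension domain, then Ω has the LLC(2) property. -/
open MeasureTheory Metric Set
open scoped ENNReal

noncomputable section

/-- Euclidean space `ℝⁿ`. -/
abbrev Eu (n : ℕ) : Type := EuclideanSpace ℝ (Fin n)

/-- A domain: a nonempty open connected subset. -/
def IsDomainEu {n : ℕ} (Ω : Set (Eu n)) : Prop := IsOpen Ω ∧ IsConnected Ω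

/-- The Hajłasz gradient class `𝒟^{s,ρ}_ball(u)` on `Ω`: nonnegative measurable `g` such that
`|u x - u y| ≤ |x-y|^s (g x + g y)` for all `x, y ∈ Ω` off a null set with
`|x - y| < ρ · dist(x, ∂Ω)`. -/
def DBall {n : ℕ} (Ω : Set (Eu n)) (s ρ : ℝ) (u : Eu n → ℝ) : Set (Eu n → ℝ) :=
  {g | Measurable g ∧ (∀ x, 0 ≤ g x) ∧
    ∃ N : Set (Eu n), N ⊆ Ω ∧ volume N = 0 ∧
      ∀ x ∈ Ω \ N, ∀ y ∈ Ω \ N,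
        edist x y < ENNReal.ofReal ρ * EMetric.infEdist x Ωᶜ →
        |u x - u y| ≤ dist x y ^ s * (g x + g y)}

/-- The full Hajłasz gradient class `𝒟^s(u)` on `U`. -/
def DFull {n : ℕ} (U : Set (Eu n)) (s : ℝ) (u : Eu n → ℝ) : Set (Eu n → ℝ) :=
  {g | Measurable g ∧ (∀ x, 0 ≤ g x) ∧
    ∃ N : Set (Eu n), N ⊆ U ∧ volume N = 0 ∧
      ∀ x ∈ U \ N, ∀ y ∈ U \ N, |u x - u y| ≤ dist x y ^ s * (g x + g y)}

/-- `inf_{g ∈ 𝒟^{s,ρ}_ball(u)} ‖g‖_{L^p(Ω)}`. -/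
def ballNormRho {n : ℕ} (Ω : Set (Eu n)) (s p ρ : ℝ) (u : Eu n → ℝ) : ℝ≥0∞ :=
  ⨅ g ∈ DBall Ω s ρ u, eLpNorm g (ENNReal.ofReal p) (volume.restrict Ω)

/-- The `Ṁ^{s,p}_ball(Ω)` seminorm (with `ρ = 1/2`). -/
def ballNorm {n : ℕ} (Ω : Set (Eu n)) (s p : ℝ) (u : Eu n → ℝ) : ℝ≥0∞ :=
  ballNormRho Ω s p (1/2) u

/-- The `Ṁ^{s,p}(U)` seminorm. -/
def fullNorm {n : ℕ} (U : Set (Eu n)) (s p : ℝ) (u : Eu n → ℝ) : ℝ≥0∞ :=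
  ⨅ g ∈ DFull U s u, eLpNorm g (ENNReal.ofReal p) (volume.restrict U)

/-- Membership in `Ṁ^{s,p}_ball(Ω)`. -/
def MemMball {n : ℕ} (Ω : Set (Eu n)) (s p : ℝ) (u : Eu n → ℝ) : Prop :=
  Measurable u ∧ ballNorm Ω s p u < ⊤

/-- Membership in `Ṁ^{s,p}(U)`. -/
def MemMfull {n : ℕ} (U : Set (Eu n)) (s p : ℝ) (u : Eu n → ℝ) : Prop :=
  Measurable u ∧ fullNorm U s p u < ⊤

/-- `Ω` supports a `(pn/(n-ps), p)_s`-Hajłasz–Sobolev–Poincaré imbedding. -/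
def SupportsHSP {n : ℕ} (Ω : Set (Eu n)) (s p : ℝ) : Prop :=
  ∃ C : ℝ, 0 < C ∧ ∀ u : Eu n → ℝ, MemMball Ω s p u →
    eLpNorm (fun x => u x - ⨍ y in Ω, u y)
        (ENNReal.ofReal (p * n / (n - p * s))) (volume.restrict Ω)
      ≤ ENNReal.ofReal C * ballNorm Ω s p u

/-- LLC(2) with constant `b`: points of `Ω \ B(z,r)` lie in the same connected component
of `Ω \ B(z, br)`. -/
def LLC2With {n : ℕ} (Ω : Set (Eu n)) (b : ℝ) : Prop :=
  ∀ (z : Eu n) (r : ℝ), 0 < r →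
    ∀ x ∈ Ω \ ball z r, ∀ y ∈ Ω \ ball z r,
      y ∈ connectedComponentIn (Ω \ ball z (b * r)) x

/-- The LLC(2) property. -/
def LLC2 {n : ℕ} (Ω : Set (Eu n)) : Prop :=
  ∃ b : ℝ, b ∈ Set.Ioo (0:ℝ) 1 ∧ LLC2With Ω b

/-- `Ω` is an `Ṁ^{s,p}_ball`-extension domain. -/
def IsMballExtensionDomain {n : ℕ} (Ω : Set (Eu n)) (s p : ℝ) : Prop :=
  ∃ C : ℝ, 0 < C ∧ ∀ u : Eu n → ℝ, MemMball Ω s p u →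
    ∃ v : Eu n → ℝ, MemMball (Set.univ) s p v ∧ (∀ x ∈ Ω, v x = u x) ∧
      ballNorm (Set.univ) s p v ≤ ENNReal.ofReal C * ballNorm Ω s p u

/-- `Ω` is a John domain: there are `x₀ ∈ Ω` and `C > 0` such that every `x ∈ Ω` is joined to
`x₀` by a curve parametrized by arclength (here: `1`-Lipschitz) with
`dist(γ t, Ωᶜ) ≥ C t`. -/
def IsJohnDomain {n : ℕ} (Ω : Set (Eu n)) : Prop :=
  ∃ x₀ ∈ Ω, ∃ C : ℝ, 0 < C ∧ ∀ x ∈ Ω, ∃ ℓ : ℝ, 0 ≤ ℓ ∧ ∃ γ : ℝ → Eu n,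
    LipschitzOnWith 1 γ (Set.Icc 0 ℓ) ∧ γ 0 = x ∧ γ ℓ = x₀ ∧
    ∀ t ∈ Set.Icc (0:ℝ) ℓ, γ t ∈ Ω ∧ C * t ≤ infDist (γ t) Ωᶜ

/-- Quasihyperbolic distance: infimum over arclength-parametrized (`1`-Lipschitz) curves in `Ω`
joining `x` to `y` of `∫ dist(γ t, Ωᶜ)⁻¹ dt`. -/
def qhDist {n : ℕ} (Ω : Set (Eu n)) (x y : Eu n) : ℝ :=
  sInf { k : ℝ | ∃ ℓ : ℝ, 0 ≤ ℓ ∧ ∃ γ : ℝ → Eu n,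
    LipschitzOnWith 1 γ (Set.Icc 0 ℓ) ∧ γ 0 = x ∧ γ ℓ = y ∧
    (∀ t ∈ Set.Icc (0:ℝ) ℓ, γ t ∈ Ω) ∧
    k = ∫ t in (0:ℝ)..ℓ, (infDist (γ t) Ωᶜ)⁻¹ }

/-- Weak carrot domain (quasihyperbolic boundary condition). -/
def IsWeakCarrot {n : ℕ} (Ω : Set (Eu n)) : Prop :=
  ∃ x₀ ∈ Ω, ∃ C : ℝ, 1 ≤ C ∧ ∀ x ∈ Ω,
    qhDist Ω x x₀ ≤ C * Real.log (C / infDist x Ωᶜ)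

/-- The Luxemburg norm `‖u‖_{φ_s(L)(Ω)}` with `φ_s(t) = exp(t^{n/(n-s)}) - 1`
(value `⊤` when no admissible `t` exists). -/
def phiLux {n : ℕ} (Ω : Set (Eu n)) (s : ℝ) (u : Eu n → ℝ) : ℝ≥0∞ :=
  sInf (ENNReal.ofReal '' { t : ℝ | 0 < t ∧
    (∫⁻ x in Ω, ENNReal.ofReal
        (Real.exp ((|u x| / t) ^ ((n : ℝ) / ((n : ℝ) - s))) - 1)) ≤ 1 })

/-- `Ω` supports an `s`-Hajłasz–Trudinger imbedding. -/
def SupportsHT {n : ℕ} (Ω : Set (Eu n)) (s : ℝ) : Prop :=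
  ∃ C : ℝ, 0 < C ∧ ∀ u : Eu n → ℝ, MemMball Ω s ((n : ℝ) / s) u →
    phiLux Ω s (fun x => u x - ⨍ y in Ω, u y)
      ≤ ENNReal.ofReal C * ballNorm Ω s ((n : ℝ) / s) u

/-- The separation property with respect to `x₀` and `C`. -/
def SeparationProperty {n : ℕ} (Ω : Set (Eu n)) (x₀ : Eu n) (C : ℝ) : Prop :=
  ∀ x ∈ Ω, ∃ γ : ℝ → Eu n, ContinuousOn γ (Set.Icc 0 1) ∧
    (∀ t ∈ Set.Icc (0:ℝ) 1, γ t ∈ Ω) ∧ γ 0 = x ∧ γ 1 = x₀ ∧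
    ∀ t ∈ Set.Ioc (0:ℝ) 1,
      γ '' Set.Icc 0 t ⊆ ball (γ t) (C * infDist (γ t) Ωᶜ) ∨
      ∀ y ∈ γ '' Set.Icc 0 t \ ball (γ t) (C * infDist (γ t) Ωᶜ),
        connectedComponentIn (Ω \ sphere (γ t) (C * infDist (γ t) Ωᶜ)) y ≠
          connectedComponentIn (Ω \ sphere (γ t) (C * infDist (γ t) Ωᶜ)) x₀

/-- The slice property with constant `C`. Lengths of curve portions are measured via the
Lebesgue measure of parameter preimages of arclength (`1`-Lipschitz) parametrizations. -/
def SliceProperty {n : ℕ} (Ω : Set (Eu n)) (C : ℝ) : Prop :=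
  ∀ x ∈ Ω, ∀ y ∈ Ω, ∃ (j : ℕ) (S : ℕ → Set (Eu n)) (L : ℝ) (γ : ℝ → Eu n),
    0 ≤ L ∧ LipschitzOnWith 1 γ (Set.Icc 0 L) ∧ γ 0 = x ∧ γ L = y ∧
    (∀ t ∈ Set.Icc (0:ℝ) L, γ t ∈ Ω) ∧
    (∀ i ≤ j, IsOpen (S i) ∧ S i ⊆ Ω) ∧
    (∀ i ≤ j, ∀ k ≤ j, i ≠ k → Disjoint (S i) (S k)) ∧
    x ∈ S 0 ∧ y ∈ S j ∧
    (∀ i, 0 < i → i < j →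
      connectedComponentIn (Ω \ closure (S i)) x ≠
        connectedComponentIn (Ω \ closure (S i)) y) ∧
    (∀ (LF : ℝ) (F : ℝ → Eu n), 0 ≤ LF → LipschitzOnWith 1 F (Set.Icc 0 LF) →
      F '' Set.Icc 0 LF ⊆ Ω → (∃ t ∈ Set.Icc (0:ℝ) LF, F t = x) →
      (∃ t ∈ Set.Icc (0:ℝ) LF, F t = y) →
      ∀ i, 0 < i → i < j →
        Metric.diam (S i) ≤ C * (volume {t : ℝ | t ∈ Set.Icc (0:ℝ) LF ∧ F t ∈ S i}).toReal) ∧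
    (∀ t ∈ Set.Icc (0:ℝ) L,
      ball (γ t) (C⁻¹ * infDist (γ t) Ωᶜ) ⊆ ⋃ i ∈ Finset.range (j + 1), S i) ∧
    (∀ i ≤ j, ∀ z ∈ γ '' Set.Icc (0:ℝ) L ∩ S i, Metric.diam (S i) ≤ C * infDist z Ωᶜ) ∧
    (∃ xi : ℕ → Eu n, xi 0 = x ∧ xi j = y ∧
      ∀ i ≤ j, xi i ∈ S i ∧ ball (xi i) (C⁻¹ * infDist (xi i) Ωᶜ) ⊆ S i)

/-- `v : Ω → ℝⁿ` is a distributional gradient of `u` on `U`. -/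
def HasDistribGradOn {n : ℕ} (U : Set (Eu n)) (u : Eu n → ℝ) (v : Eu n → Eu n) : Prop :=
  ∀ φ : Eu n → ℝ, ContDiff ℝ (⊤ : ℕ∞) φ → HasCompactSupport φ → tsupport φ ⊆ U →
    ∀ i : Fin n,
      ∫ x in U, u x * fderiv ℝ φ x (EuclideanSpace.single i 1) = - ∫ x in U, v x i * φ x

/-- `u ∈ Ẇ^{1,p}(U)` with distributional gradient `v ∈ L^p(U;ℝⁿ)`. -/
def MemW1p {n : ℕ} (U : Set (Eu n)) (p : ℝ) (u : Eu n → ℝ) (v : Eu n → Eu n) : Prop :=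
  LocallyIntegrableOn u U volume ∧ AEMeasurable v (volume.restrict U) ∧
    eLpNorm v (ENNReal.ofReal p) (volume.restrict U) < ⊤ ∧ HasDistribGradOn U u v

/-- `Ω` is a `Ẇ^{1,p}`-extension domain. -/
def IsW1pExtensionDomain {n : ℕ} (Ω : Set (Eu n)) (p : ℝ) : Prop :=
  ∃ C : ℝ, 0 < C ∧ ∀ u v, MemW1p Ω p u v →
    ∃ u' v', MemW1p (Set.univ) p u' v' ∧ (∀ᵐ x ∂(volume.restrict Ω), u' x = u x) ∧
      eLpNorm v' (ENNReal.ofReal p) volume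
        ≤ ENNReal.ofReal C * eLpNorm v (ENNReal.ofReal p) (volume.restrict Ω)

/-- The (uncentered over radii, centered) Hardy–Littlewood maximal function, `ℝ≥0∞`-valued. -/
def HLMax {n : ℕ} (g : Eu n → ℝ) (y : Eu n) : ℝ≥0∞ :=
  ⨆ (t : ℝ) (_ : 0 < t), (volume (ball y t))⁻¹ * ∫⁻ z in ball y t, ENNReal.ofReal |g z|

lemma chain_aux {X : Type*} [PseudoMetricSpace X] (v g : X → ℝ) (N : Set X) (s a r0 l0 : ℝ)
    (hs : 0 < s) (ha : 1 ≤ a) (hq : a ^ s / 2 < 1) (hr : 0 < r0) (hl : 0 < l0)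
    (hv : ∀ x, x ∉ N → ∀ y, y ∉ N → |v x - v y| ≤ dist x y ^ s * (g x + g y))
    (hd : ∀ (x : X) (j : ℕ), ∃ y ∈ ball x (r0 * a ^ j), y ∉ N ∧ g y < l0 * (1/2) ^ j)
    (x0 y0 : X) (hx : x0 ∉ N) (hgx : g x0 < l0) (hy : y0 ∉ N) (hgy : g y0 < l0) :
    |v x0 - v y0| ≤ 2 * ((2 * 2 ^ s * a ^ s) * (1 / (1 - a ^ s / 2) + 1)) * (r0 ^ s * l0) := by
  set q := a ^ s / 2 with hqd
  have ha0 : 0 < a := by linarith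
  have hq0 : 0 < q := by positivity
  set T := (2 * 2 ^ s * a ^ s) * (r0 ^ s * l0) with hT
  have hT0 : 0 < T := by positivity
  have h1s : (1:ℝ) ≤ 2 ^ s := Real.one_le_rpow (by norm_num) hs.le
  have has : (1:ℝ) ≤ a ^ s := Real.one_le_rpow ha hs.le
  have powq : ∀ j : ℕ, (a ^ j) ^ s * (1/2) ^ j = q ^ j := by
    intro j
    rw [hqd, ← Real.rpow_natCast a j, ← Real.rpow_mul ha0.le, mul_comm (j:ℝ) s, Real.rpow_mul ha0.le,
      Real.rpow_natCast, ← mul_pow]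
    congr 1; ring
  have key : ∀ x0 : X, x0 ∉ N → g x0 < l0 → ∃ Y : ℕ → X, ∀ j, Y j ∈ ball x0 (r0 * a ^ j) ∧ Y j ∉ N ∧
      g (Y j) < l0 * (1/2) ^ j ∧ |v x0 - v (Y j)| ≤ T * (1 / (1 - q) + 1) := by
    intro x0 hx hgx
    choose Y hYb hYN hYg using fun j => hd x0 j
    refine ⟨Y, fun j => ⟨hYb j, hYN j, hYg j, ?_⟩⟩
    have h : ∀ j, |v x0 - v (Y j)| ≤ T * ((1 - q ^ j) / (1 - q) + 1) := by
      intro j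
      induction j with
      | zero =>
        have h1 := hv x0 hx (Y 0) (hYN 0)
        have h2 := hYg 0
        have h3 := hYb 0
        simp only [pow_zero, mul_one, mem_ball] at h2 h3
        rw [dist_comm] at h3
        have h4 : dist x0 (Y 0) ^ s ≤ r0 ^ s := Real.rpow_le_rpow dist_nonneg h3.le hs.le
        have h5 : dist x0 (Y 0) ^ s * (g x0 + g (Y 0)) ≤ r0 ^ s * (2 * l0) := by
          calc _ ≤ dist x0 (Y 0) ^ s * (2 * l0) := by
                apply mul_le_mul_of_nonneg_left (by linarith) (by positivity)
            _ ≤ _ := by gcongr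
        have h6 : r0 ^ s * (2 * l0) ≤ T := by
          have : 1 ≤ (2:ℝ) ^ s * a ^ s := by nlinarith
          have h7 : 0 < r0 ^ s * (2 * l0) := by positivity
          calc r0 ^ s * (2 * l0) = r0 ^ s * (2 * l0) * 1 := by ring
            _ ≤ r0 ^ s * (2 * l0) * (2 ^ s * a ^ s) := by gcongr
            _ = T := by rw [hT]; ring
        simp only [pow_zero, sub_self, zero_div, zero_add, mul_one]
        linarith
      | succ j ih =>
        have h1 := hv (Y j) (hYN j) (Y (j+1)) (hYN (j+1))
        have h2 : dist (Y j) (Y (j+1)) ≤ 2 * (r0 * (a ^ j * a)) := by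
          have e1 := hYb j
          have e2 := hYb (j+1)
          rw [mem_ball] at e1 e2
          have e3 := dist_triangle_right (Y j) (Y (j+1)) x0
          have e4 : r0 * a ^ j ≤ r0 * a ^ (j+1) := by
            gcongr
            omega
          rw [pow_succ] at *
          linarith
        have h3 : g (Y j) + g (Y (j+1)) ≤ 2 * (l0 * (1/2) ^ j) := by
          have e1 := hYg j
          have e2 := hYg (j+1)
          have e3 : 0 < l0 * (1/2) ^ j := by positivity
          rw [pow_succ] at e2
          linarith
        have h4 : dist (Y j) (Y (j+1)) ^ s ≤ (2 * (r0 * (a ^ j * a))) ^ s :=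
          Real.rpow_le_rpow dist_nonneg h2 hs.le
        have h5 : |v (Y j) - v (Y (j+1))| ≤ T * q ^ j := by
          calc _ ≤ _ := h1
            _ ≤ dist (Y j) (Y (j+1)) ^ s * (2 * (l0 * (1/2) ^ j)) := by
                apply mul_le_mul_of_nonneg_left h3 (by positivity)
            _ ≤ (2 * (r0 * (a ^ j * a))) ^ s * (2 * (l0 * (1/2) ^ j)) := by gcongr
            _ = T * ((a ^ j) ^ s * (1/2) ^ j) := by
                rw [Real.mul_rpow (by norm_num) (by positivity), Real.mul_rpow hr.le (by positivity),
                  Real.mul_rpow (by positivity) ha0.le, hT]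
                ring
            _ = _ := by rw [powq]
        have h6 := abs_sub_le (v x0) (v (Y j)) (v (Y (j+1)))
        have h7 : T * ((1 - q ^ (j+1)) / (1 - q) + 1) = T * ((1 - q ^ j) / (1 - q) + 1) + T * q ^ j := by
          have : 1 - q ≠ 0 := by linarith
          field_simp
          ring
        linarith
    refine (h j).trans ?_
    have : 0 < 1 - q := by linarith
    gcongr
    have : 0 < q ^ j := by positivity
    linarith
  obtain ⟨Y, hY⟩ := key x0 hx hgx
  obtain ⟨Z, hZ⟩ := key y0 hy hgy
  set D := dist x0 y0 with hD
  have hD0 : 0 ≤ D := dist_nonneg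
  have fin : ∀ j : ℕ, |v x0 - v y0| ≤ 2 * (T * (1 / (1 - q) + 1)) + (D + 2 * r0) ^ s * (2 * l0) * q ^ j := by
    intro j
    obtain ⟨a1, a2, a3, a4⟩ := hY j
    obtain ⟨b1, b2, b3, b4⟩ := hZ j
    have h1 := hv (Y j) a2 (Z j) b2
    have haj : 1 ≤ a ^ j := one_le_pow₀ ha
    have h2 : dist (Y j) (Z j) ≤ (D + 2 * r0) * a ^ j := by
      rw [mem_ball] at a1 b1
      have e := dist_triangle4_right x0 y0 (Y j) (Z j)
      have e1 := dist_triangle4 (Y j) x0 y0 (Z j)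
      rw [dist_comm y0] at e1
      nlinarith
    have h4 : dist (Y j) (Z j) ^ s ≤ ((D + 2 * r0) * a ^ j) ^ s :=
          Real.rpow_le_rpow dist_nonneg h2 hs.le
    have h5 : |v (Y j) - v (Z j)| ≤ (D + 2 * r0) ^ s * (2 * l0) * q ^ j := by
      calc _ ≤ _ := h1
        _ ≤ dist (Y j) (Z j) ^ s * (2 * (l0 * (1/2) ^ j)) := by
            apply mul_le_mul_of_nonneg_left (by linarith) (by positivity)
        _ ≤ ((D + 2 * r0) * a ^ j) ^ s * (2 * (l0 * (1/2) ^ j)) := by gcongr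
        _ = (D + 2 * r0) ^ s * (2 * l0) * ((a ^ j) ^ s * (1/2) ^ j) := by
            rw [Real.mul_rpow (by positivity) (by positivity)]
            ring
        _ = _ := by rw [powq]
    have h6 := abs_sub_le (v x0) (v (Y j)) (v y0)
    have h7 := abs_sub_le (v (Y j)) (v (Z j)) (v y0)
    rw [abs_sub_comm] at b4
    linarith
  have lim : Filter.Tendsto (fun j : ℕ => 2 * (T * (1 / (1 - q) + 1)) + (D + 2 * r0) ^ s * (2 * l0) * q ^ j)
      Filter.atTop (nhds (2 * (T * (1 / (1 - q) + 1)) + (D + 2 * r0) ^ s * (2 * l0) * 0)) :=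
    ((tendsto_pow_atTop_nhds_zero_of_lt_one hq0.le hq).const_mul _).const_add _
  have := ge_of_tendsto' lim fin
  rw [mul_zero, add_zero] at this
  refine this.trans (le_of_eq ?_)
  rw [hT]; ring

lemma twoSet {n : ℕ} (hn : 2 ≤ n) (s p : ℝ) (hs : 0 < s) (hp : 0 < p) (hps : p * s < n) :
    ∃ K : ℝ, 0 < K ∧ ∀ (v g : Eu n → ℝ) (N A0 A1 : Set (Eu n)) (G m : ℝ), Measurable g → (∀ x, 0 ≤ g x) →
      volume N = 0 → (∀ x, x ∉ N → ∀ y, y ∉ N → |v x - v y| ≤ dist x y ^ s * (g x + g y)) →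
      0 < G → 0 < m → eLpNorm g (ENNReal.ofReal p) volume ≤ ENNReal.ofReal G →
      ENNReal.ofReal m ≤ volume A0 → ENNReal.ofReal m ≤ volume A1 →
      (∀ x ∈ A0, v x = 0) → (∀ x ∈ A1, v x = 1) → m ^ (1 / p - s / n) ≤ K * G := by
  have hn0 : (0:ℝ) < n := by positivity
  have hne : Nonempty (Fin n) := ⟨⟨0, by omega⟩⟩
  set ω := (volume (ball (0 : Eu n) 1)).toReal with hω
  have hω' : volume (ball (0 : Eu n) 1) = ENNReal.ofReal ω :=
    (ENNReal.ofReal_toReal measure_ball_lt_top.ne).symm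
  have hω0 : 0 < ω := ENNReal.toReal_pos (measure_ball_pos _ _ one_pos).ne' measure_ball_lt_top.ne
  set a := (2:ℝ) ^ (p / n) with ha
  have ha1 : 1 ≤ a := Real.one_le_rpow (by norm_num) (by positivity)
  have han : a ^ n = 2 ^ p := by
    rw [ha, ← Real.rpow_natCast, ← Real.rpow_mul (by norm_num)]
    congr 1; field_simp
  have hq : a ^ s / 2 < 1 := by
    rw [div_lt_one (by norm_num), ha, ← Real.rpow_mul (by norm_num)]
    conv_rhs => rw [← Real.rpow_one 2]
    apply Real.rpow_lt_rpow_of_exponent_lt (by norm_num)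
    rw [div_mul_eq_mul_div, div_lt_one hn0]; exact hps
  set K1 := 2 * ((2 * 2 ^ s * a ^ s) * (1 / (1 - a ^ s / 2) + 1)) with hK1
  have hK1p : 0 < K1 := by
    have : 0 < 1 - a ^ s / 2 := by linarith
    positivity
  refine ⟨K1 * ((1/ω) ^ (s / n) * 2 ^ (1/p)), by positivity, ?_⟩
  intro v g N A0 A1 G m hg hg0 hN hv hG hm hGn hA0 hA1 hv0 hv1
  set l0 := (2 / m) ^ (1/p) * G with hl
  set r0 := (m / ω) ^ (1 / (n:ℝ)) with hr
  have hl0 : 0 < l0 := by positivity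
  have hr0 : 0 < r0 := by positivity
  have cheb : ∀ j : ℕ, volume {x | l0 * (1/2) ^ j ≤ g x} ≤ ENNReal.ofReal (m / 2 * (2 ^ p) ^ j) := by
    intro j
    have hlj : 0 < l0 * (1/2) ^ j := by positivity
    have h := meas_ge_le_mul_pow_eLpNorm_enorm (μ := (volume : Measure (Eu n)))
      (p := ENNReal.ofReal p) (by simpa using hp) ENNReal.ofReal_ne_top (f := g)
      hg.aestronglyMeasurable (ε := ENNReal.ofReal (l0 * (1/2) ^ j)) (by simpa using hlj) (by simp)
    have hset : {x | l0 * (1/2) ^ j ≤ g x} = {x | ENNReal.ofReal (l0 * (1/2) ^ j) ≤ ‖g x‖ₑ} := by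
      ext x
      simp only [Set.mem_ofPred_eq]
      rw [Real.enorm_eq_ofReal (hg0 x), ENNReal.ofReal_le_ofReal_iff (hg0 x)]
    rw [hset]
    refine h.trans ?_
    rw [ENNReal.toReal_ofReal hp.le, ← ENNReal.ofReal_inv_of_pos hlj,
      ENNReal.ofReal_rpow_of_pos (by positivity)]
    calc _ ≤ ENNReal.ofReal (((l0 * (1/2) ^ j)⁻¹) ^ p) * (ENNReal.ofReal G) ^ p := by gcongr
      _ = ENNReal.ofReal (((l0 * (1/2) ^ j)⁻¹) ^ p * G ^ p) := by
        rw [ENNReal.ofReal_rpow_of_pos hG, ENNReal.ofReal_mul (by positivity)]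
      _ ≤ _ := by
        apply ENNReal.ofReal_le_ofReal
        apply le_of_eq
        rw [← Real.mul_rpow (by positivity) hG.le]
        have : (l0 * (1/2) ^ j)⁻¹ * G = (m/2) ^ (1/p) * 2 ^ j := by
          rw [hl, show m / 2 = (2/m)⁻¹ by field_simp, Real.inv_rpow (by positivity)]
          have : (2/m) ^ (1/p) ≠ 0 := by positivity
          field_simp
          rw [← mul_pow]; norm_num
        rw [this, Real.mul_rpow (by positivity) (by positivity), ← Real.rpow_mul (by positivity),
          one_div_mul_cancel hp.ne', Real.rpow_one, ← Real.rpow_natCast, ← Real.rpow_natCast,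
          ← Real.rpow_mul (by norm_num), ← Real.rpow_mul (by norm_num), mul_comm p]
  have exi : ∀ (A : Set (Eu n)) (j : ℕ), ENNReal.ofReal (m * (2 ^ p) ^ j) ≤ volume A →
      ∃ y ∈ A, y ∉ N ∧ g y < l0 * (1/2) ^ j := by
    intro A j hA
    by_contra hcon
    push Not at hcon
    have hsub : A ⊆ N ∪ {x | l0 * (1/2) ^ j ≤ g x} := by
      intro x hx
      by_cases hxN : x ∈ N
      · exact Or.inl hxN
      · exact Or.inr (hcon x hx hxN)
    have h1 : volume A ≤ ENNReal.ofReal (m / 2 * (2 ^ p) ^ j) := by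
      calc _ ≤ _ := measure_mono hsub
        _ ≤ _ := measure_union_le _ _
        _ = volume {x | l0 * (1/2) ^ j ≤ g x} := by rw [hN, zero_add]
        _ ≤ _ := cheb j
    have h2 := (ENNReal.ofReal_le_ofReal_iff (by positivity)).1 (hA.trans h1)
    have h3 : 0 < m * ((2:ℝ) ^ p) ^ j := by positivity
    linarith
  have hd : ∀ (x : Eu n) (j : ℕ), ∃ y ∈ ball x (r0 * a ^ j), y ∉ N ∧ g y < l0 * (1/2) ^ j := by
    intro x j
    apply exi
    rw [Measure.addHaar_ball _ _ (by positivity), hω', ← ENNReal.ofReal_mul (by positivity)]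
    apply ENNReal.ofReal_le_ofReal
    apply le_of_eq
    rw [finrank_euclideanSpace_fin, mul_pow, ← pow_mul, mul_comm j n, pow_mul, han, hr,
      ← Real.rpow_natCast ((m/ω) ^ (1 / (n:ℝ))) n, ← Real.rpow_mul (by positivity), one_div_mul_cancel hn0.ne', Real.rpow_one]
    field_simp
  obtain ⟨x0, hx0, hx0N, hx0g⟩ := exi A1 0 (by simpa using hA1)
  obtain ⟨y0, hy0, hy0N, hy0g⟩ := exi A0 0 (by simpa using hA0)
  simp only [pow_zero, mul_one] at hx0g hy0g
  have main := chain_aux v g N s a r0 l0 hs ha1 hq hr0 hl0 hv hd x0 y0 hx0N hx0g hy0N hy0g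
  rw [hv1 _ hx0, hv0 _ hy0, sub_zero, abs_one, ← hK1] at main
  have e : r0 ^ s * l0 = m ^ (-(1/p - s/n)) * (((1/ω) ^ (s / n) * 2 ^ (1/p)) * G) := by
    rw [hr, hl, ← Real.rpow_mul (by positivity), one_div_mul_eq_div, Real.div_rpow hm.le hω0.le,
      Real.div_rpow (by norm_num) hm.le, Real.div_rpow (by norm_num) hω0.le, Real.one_rpow,
      neg_sub, Real.rpow_sub hm]
    field_simp
  rw [e, Real.rpow_neg hm.le] at main
  have hmp : 0 < m ^ (1/p - s/n) := by positivity
  calc m ^ (1/p - s/n) = m ^ (1/p - s/n) * 1 := by ring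
    _ ≤ m ^ (1/p - s/n) * (K1 * ((m ^ (1 / p - s / ↑n))⁻¹ * ((1 / ω) ^ (s / ↑n) * 2 ^ (1 / p) * G))) := by gcongr
    _ = _ := by field_simp

lemma testIneq {n : ℕ} (hn : 2 ≤ n) (s p : ℝ) (hs : 0 < s) (hp : 0 < p) (hps : p * s < n)
    (Ω : Set (Eu n)) (hext : IsMballExtensionDomain Ω s p) :
    ∃ K : ℝ, 0 < K ∧ ∀ (u : Eu n → ℝ) (S A0 A1 : Set (Eu n)) (d M m : ℝ), Measurable u →
      MeasurableSet S → 0 < d → 0 < M → 0 < m →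
      (∀ x ∈ Ω, ∀ y ∈ Ω, edist x y < ENNReal.ofReal (1/2) * EMetric.infEdist x Ωᶜ →
        |u x - u y| ≤ (dist x y / d) ^ s) →
      (∀ x ∈ Ω, ∀ y ∈ Ω, edist x y < ENNReal.ofReal (1/2) * EMetric.infEdist x Ωᶜ →
        x ∉ S → y ∉ S → u x = u y) →
      A0 ⊆ Ω → A1 ⊆ Ω → (∀ x ∈ A0, u x = 0) → (∀ x ∈ A1, u x = 1) →
      volume S ≤ ENNReal.ofReal M → ENNReal.ofReal m ≤ volume A0 → ENNReal.ofReal m ≤ volume A1 →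
      m ^ (1 / p - s / n) ≤ K * (d ^ (-s) * M ^ (1/p)) := by
  obtain ⟨K, hK, hmain⟩ := twoSet hn s p hs hp hps
  obtain ⟨C, hC, hE⟩ := hext
  refine ⟨K * (2 * C), by positivity, ?_⟩
  intro u S A0 A1 d M m hu hS hd hM hm hlip hloc hA0 hA1 hu0 hu1 hSM hmA0 hmA1
  have hds : 0 < d ^ (-s) := by positivity
  have hnorm : ballNorm Ω s p u ≤ ENNReal.ofReal (d ^ (-s) * M ^ (1/p)) := by
    have hmem : S.indicator (fun _ => d ^ (-s)) ∈ DBall Ω s (1/2) u := by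
      refine ⟨measurable_const.indicator hS, fun x => indicator_nonneg (fun _ _ => hds.le) x,
        ∅, empty_subset _, measure_empty, ?_⟩
      intro x hx y hy hxy
      have hx := hx.1
      have hy := hy.1
      by_cases hxy' : x ∉ S ∧ y ∉ S
      · rw [hloc x hx y hy hxy hxy'.1 hxy'.2, sub_self, abs_zero]
        have := fun x => indicator_nonneg (s := S) (f := fun _ : Eu n => d ^ (-s)) (fun _ _ => hds.le) x
        have h1 := this x
        have h2 := this y
        positivity
      · refine (hlip x hx y hy hxy).trans ?_
        rw [Real.div_rpow dist_nonneg hd.le, div_eq_mul_inv, ← Real.rpow_neg hd.le]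
        apply mul_le_mul_of_nonneg_left _ (by positivity)
        by_cases h1 : x ∈ S
        · by_cases h2 : y ∈ S
          · simp [h1, h2, hds.le]
          · simp [h1, h2]
        · by_cases h2 : y ∈ S
          · simp [h1, h2]
          · exact absurd ⟨h1, h2⟩ hxy'
    refine (iInf₂_le _ hmem).trans ?_
    refine (eLpNorm_mono_measure _ Measure.restrict_le_self).trans ?_
    rw [eLpNorm_indicator_const hS (by simpa using hp) ENNReal.ofReal_ne_top,
      Real.enorm_eq_ofReal hds.le, ENNReal.toReal_ofReal hp.le, ENNReal.ofReal_mul hds.le]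
    gcongr
    rw [← ENNReal.ofReal_rpow_of_pos hM]
    gcongr
  obtain ⟨v, hv, hvu, hvn⟩ := hE u ⟨hu, hnorm.trans_lt ENNReal.ofReal_lt_top⟩
  set Q := d ^ (-s) * M ^ (1/p) with hQ
  have hQ0 : 0 < Q := by positivity
  have hlt : ballNorm univ s p v < ENNReal.ofReal (2 * C * Q) := by
    calc _ ≤ _ := hvn
      _ ≤ ENNReal.ofReal C * ENNReal.ofReal Q := by gcongr
      _ = ENNReal.ofReal (C * Q) := by rw [ENNReal.ofReal_mul hC.le]
      _ < _ := by
        rw [ENNReal.ofReal_lt_ofReal_iff (by positivity)]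
        have : 0 < C * Q := by positivity
        linarith
  unfold ballNorm ballNormRho at hlt
  simp only [iInf_lt_iff] at hlt
  obtain ⟨g, ⟨hgm, hg0, N, -, hN, hgv⟩, hgl⟩ := hlt
  rw [Measure.restrict_univ] at hgl
  have := hmain v g N A0 A1 (2 * C * Q) m hgm hg0 hN ?_ (by positivity) hm hgl.le hmA0 hmA1
    (fun x hx => by rw [hvu x (hA0 hx), hu0 x hx]) (fun x hx => by rw [hvu x (hA1 hx), hu1 x hx])
  · refine this.trans (le_of_eq ?_); ring
  · intro x hx y hy
    apply hgv x ⟨mem_univ _, hx⟩ y ⟨mem_univ _, hy⟩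
    rw [compl_univ]
    have : EMetric.infEdist x (∅ : Set (Eu n)) = ⊤ := Metric.infEDist_empty
    rw [this, ENNReal.mul_top (by simp)]
    exact edist_lt_top _ _

lemma near_mem {n : ℕ} {Ω : Set (Eu n)} {x y w : Eu n}
    (h : edist x y < ENNReal.ofReal (1/2) * EMetric.infEdist x Ωᶜ) (hw : dist x w ≤ 2 * dist x y) :
    w ∈ Ω := by
  by_contra hcon
  have h1 : EMetric.infEdist x Ωᶜ ≤ edist x w := Metric.infEDist_le_edist_of_mem hcon
  have h2 : edist x y < ENNReal.ofReal (1/2) * edist x w := h.trans_le (by gcongr)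
  rw [edist_dist, edist_dist, ← ENNReal.ofReal_mul (by norm_num), ENNReal.ofReal_lt_ofReal_iff'] at h2
  linarith [h2.1]

lemma seg_mem {n : ℕ} {Ω : Set (Eu n)} {x y w : Eu n} (hx : x ∈ Ω)
    (h : edist x y < ENNReal.ofReal (1/2) * EMetric.infEdist x Ωᶜ) (hw : w ∈ segment ℝ x y) :
    w ∈ Ω := by
  apply near_mem h
  have := dist_add_dist_of_mem_segment hw
  have h1 : 0 ≤ dist w y := dist_nonneg
  have h2 : 0 ≤ dist x w := dist_nonneg
  linarith

lemma comp_mem {α : Type*} [TopologicalSpace α] {F C : Set α} {x0 a b : α} (hC : IsPreconnected C)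
    (hCF : C ⊆ F) (ha : a ∈ C) (hb : b ∈ C) (haU : a ∈ connectedComponentIn F x0) :
    b ∈ connectedComponentIn F x0 := by
  rw [connectedComponentIn_eq haU]
  exact hC.subset_connectedComponentIn ha hCF hb

lemma cut_lip {n : ℕ} {Ω : Set (Eu n)} {z x0 : Eu n} {ρ d s : ℝ} (hs : 0 < s) (hs1 : s ≤ 1) (hd : 0 < d)
    (η : Eu n → ℝ) (h0 : ∀ x, 0 ≤ η x) (h1 : ∀ x, η x ≤ 1) (hl : ∀ x y, |η x - η y| ≤ dist x y / d)
    (hz : ∀ x ∈ ball z ρ, η x = 0) (x : Eu n) (hx : x ∈ Ω) (y : Eu n) 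
    (hxy : edist x y < ENNReal.ofReal (1/2) * EMetric.infEdist x Ωᶜ) :
    |(connectedComponentIn (Ω \ ball z ρ) x0).indicator η x -
      (connectedComponentIn (Ω \ ball z ρ) x0).indicator η y| ≤ (dist x y / d) ^ s := by
  set U := connectedComponentIn (Ω \ ball z ρ) x0 with hU
  have hb0 : 0 ≤ dist x y / d := by positivity
  have main : |U.indicator η x - U.indicator η y| ≤ dist x y / d ∧
      |U.indicator η x - U.indicator η y| ≤ 1 := by
    have hseg : ((x ∈ U ∧ y ∉ U) ∨ (x ∉ U ∧ y ∈ U)) → ∃ w ∈ segment ℝ x y, w ∈ ball z ρ := by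
      intro h
      by_contra hcon
      push Not at hcon
      have hsub : segment ℝ x y ⊆ Ω \ ball z ρ := fun w hw => ⟨seg_mem hx hxy hw, hcon w hw⟩
      have hpc : IsPreconnected (segment ℝ x y) := (convex_segment x y).isPreconnected
      rcases h with ⟨h1, h2⟩ | ⟨h1, h2⟩
      · exact h2 (comp_mem hpc hsub (left_mem_segment _ _ _) (right_mem_segment _ _ _) h1)
      · exact h1 (comp_mem hpc hsub (right_mem_segment _ _ _) (left_mem_segment _ _ _) h2)
    by_cases hxU : x ∈ U <;> by_cases hyU : y ∈ U
    · simp only [indicator_of_mem hxU, indicator_of_mem hyU]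
      refine ⟨hl x y, ?_⟩
      have := h0 x; have := h0 y; have := h1 x; have := h1 y
      rw [abs_le]; constructor <;> linarith
    · obtain ⟨w, hw, hwb⟩ := hseg (Or.inl ⟨hxU, hyU⟩)
      simp only [indicator_of_mem hxU, indicator_of_notMem hyU, sub_zero, abs_of_nonneg (h0 x)]
      refine ⟨?_, h1 x⟩
      have e := hl x w
      rw [hz w hwb, sub_zero, abs_of_nonneg (h0 x)] at e
      refine e.trans ?_
      have := dist_add_dist_of_mem_segment hw
      have h1 : 0 ≤ dist w y := dist_nonneg
      gcongr; linarith
    · obtain ⟨w, hw, hwb⟩ := hseg (Or.inr ⟨hxU, hyU⟩)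
      simp only [indicator_of_mem hyU, indicator_of_notMem hxU, zero_sub, abs_neg, abs_of_nonneg (h0 y)]
      refine ⟨?_, h1 y⟩
      have e := hl y w
      rw [hz w hwb, sub_zero, abs_of_nonneg (h0 y)] at e
      refine e.trans ?_
      have := dist_add_dist_of_mem_segment hw
      have h1 : 0 ≤ dist x w := dist_nonneg
      rw [dist_comm y w]
      gcongr; linarith
    · simp only [indicator_of_notMem hxU, indicator_of_notMem hyU, sub_zero, abs_zero]
      exact ⟨hb0, zero_le_one⟩
  rcases le_total (dist x y / d) 1 with h | h
  · exact main.1.trans (Real.self_le_rpow_of_le_one hb0 h hs1)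
  · exact main.2.trans (Real.one_le_rpow h hs.le)

lemma seg_radial {n : ℕ} {z x : Eu n} {ρ : ℝ} (hρ : 0 < ρ) (hx : 2 * ρ ≤ dist x z) :
    ∃ q ∈ sphere z ρ, ∀ w ∈ segment ℝ x q, w ∉ ball z ρ := by
  have hp : 0 < ‖x - z‖ := by rw [← dist_eq_norm]; linarith
  rw [dist_eq_norm] at hx
  refine ⟨z + (ρ / ‖x - z‖) • (x - z), ?_, ?_⟩
  · rw [mem_sphere, dist_eq_norm, add_sub_cancel_left, norm_smul, Real.norm_of_nonneg (by positivity)]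
    field_simp
  · rintro w ⟨α, β, hα, hβ, hab, rfl⟩
    rw [mem_ball, not_lt, dist_eq_norm]
    have : α • x + β • (z + (ρ / ‖x - z‖) • (x - z)) - z = (α + β * (ρ / ‖x - z‖)) • (x - z) := by
      have hα' : α = 1 - β := by linarith
      rw [hα']
      module
    rw [this, norm_smul, Real.norm_of_nonneg (by positivity), add_mul]
    have : β * (ρ / ‖x - z‖) * ‖x - z‖ = β * ρ := by field_simp
    rw [this]
    nlinarith

lemma around {n : ℕ} (hn : 2 ≤ n) {Ω : Set (Eu n)} {z x0 : Eu n} {ρ : ℝ} (hρ : 0 < ρ)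
    (x : Eu n) (hx : x ∈ Ω) (y : Eu n) (hy : y ∈ Ω) 
    (hxy : edist x y < ENNReal.ofReal (1/2) * EMetric.infEdist x Ωᶜ)
    (hxz : x ∉ ball z (2 * ρ)) (hyz : y ∉ ball z (2 * ρ)) :
    x ∈ connectedComponentIn (Ω \ ball z ρ) x0 ↔ y ∈ connectedComponentIn (Ω \ ball z ρ) x0 := by
  suffices h : ∃ C : Set (Eu n), IsPreconnected C ∧ C ⊆ Ω \ ball z ρ ∧ x ∈ C ∧ y ∈ C by
    obtain ⟨C, h1, h2, h3, h4⟩ := h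
    exact ⟨comp_mem h1 h2 h3 h4, comp_mem h1 h2 h4 h3⟩
  by_cases hcon : ∃ w ∈ segment ℝ x y, w ∈ ball z ρ
  · obtain ⟨w, hw, hwz⟩ := hcon
    rw [mem_ball, not_lt] at hxz hyz
    rw [mem_ball] at hwz
    have e1 := dist_add_dist_of_mem_segment hw
    have e2 := dist_triangle y w z
    have e3 := dist_triangle x w z
    rw [dist_comm y w] at e2
    have e4 : dist x z ≤ dist x y := by linarith
    have hsph : sphere z ρ ⊆ closedBall x (2 * dist x y) := by
      intro q hq
      rw [mem_sphere] at hq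
      rw [mem_closedBall]
      have := dist_triangle q z x
      rw [dist_comm z x] at this
      linarith
    have hcb : closedBall x (2 * dist x y) ⊆ Ω := by
      intro q hq
      rw [mem_closedBall, dist_comm] at hq
      exact near_mem hxy hq
    obtain ⟨q1, hq1, hs1⟩ := seg_radial hρ hxz
    obtain ⟨q2, hq2, hs2⟩ := seg_radial hρ hyz
    have hcv : Convex ℝ (closedBall x (2 * dist x y)) := convex_closedBall _ _
    have hrank : 1 < Module.rank ℝ (Eu n) := by
      rw [← Module.finrank_eq_rank, finrank_euclideanSpace_fin]
      exact_mod_cast hn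
    refine ⟨segment ℝ x q1 ∪ sphere z ρ ∪ segment ℝ y q2, ?_, ?_, ?_, ?_⟩
    · refine IsPreconnected.union q2 (Or.inr hq2) (right_mem_segment _ _ _) ?_ (convex_segment _ _).isPreconnected
      exact IsPreconnected.union q1 (right_mem_segment _ _ _) hq1 (convex_segment _ _).isPreconnected
        (isPreconnected_sphere hrank _ _)
    · rintro w ((hw | hw) | hw)
      · exact ⟨hcb (hcv.segment_subset (mem_closedBall_self (by positivity)) (hsph hq1) hw), hs1 w hw⟩
      · refine ⟨hcb (hsph hw), ?_⟩
        rw [mem_sphere] at hw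
        rw [mem_ball, hw]; exact lt_irrefl _
      · refine ⟨hcb (hcv.segment_subset ?_ (hsph hq2) hw), hs2 w hw⟩
        rw [mem_closedBall, dist_comm]
        have : 0 ≤ dist x y := dist_nonneg
        linarith
    · exact Or.inl (Or.inl (left_mem_segment _ _ _))
    · exact Or.inr (left_mem_segment _ _ _)
  · push Not at hcon
    exact ⟨segment ℝ x y, (convex_segment x y).isPreconnected, fun w hw => ⟨seg_mem hx hxy hw, hcon w hw⟩,
      left_mem_segment _ _ _, right_mem_segment _ _ _⟩

lemma meas_comp {n : ℕ} {F : Set (Eu n)} (hF : MeasurableSet F) (x : Eu n) :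
    MeasurableSet (connectedComponentIn F x) := by
  have : connectedComponentIn F x = closure (connectedComponentIn F x) ∩ F := by
    apply subset_antisymm
    · exact subset_inter subset_closure (connectedComponentIn_subset F x)
    · by_cases hx : x ∈ F
      · apply IsPreconnected.subset_connectedComponentIn _ _ inter_subset_right
        · exact isPreconnected_connectedComponentIn.subset_closure
            (subset_inter subset_closure (connectedComponentIn_subset F x)) inter_subset_left
        · exact ⟨subset_closure (mem_connectedComponentIn hx), hx⟩
      · rw [connectedComponentIn_eq_empty hx]; simp
  rw [this]
  exact isClosed_closure.measurableSet.inter hF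

def clamp (a : ℝ) : ℝ := max 0 (min 1 a)
lemma clamp_nonneg (a : ℝ) : 0 ≤ clamp a := le_max_left _ _
lemma clamp_le (a : ℝ) : clamp a ≤ 1 := max_le zero_le_one (min_le_left _ _)
lemma clamp_lip (a b : ℝ) : |clamp a - clamp b| ≤ |a - b| := by
  unfold clamp
  have h1 : |max 0 (min 1 a) - max 0 (min 1 b)| ≤ |min 1 a - min 1 b| := by
    have := abs_max_sub_max_le_max 0 (min 1 a) 0 (min 1 b)
    simpa using this
  have h2 : |min 1 a - min 1 b| ≤ |a - b| := by
    have := abs_min_sub_min_le_max 1 a 1 b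
    simpa using this
  exact h1.trans h2
lemma clamp_zero {a : ℝ} (h : a ≤ 0) : clamp a = 0 := max_eq_left ((min_le_right _ _).trans h)
lemma clamp_one {a : ℝ} (h : 1 ≤ a) : clamp a = 1 := by unfold clamp; rw [min_eq_left h]; exact max_eq_right zero_le_one
lemma clamp_meas : Measurable clamp := measurable_const.max (measurable_const.min measurable_id)

lemma density {n : ℕ} (hn : 2 ≤ n) (s p K : ℝ) (hs : 0 < s) (hs1 : s ≤ 1) (hp : 0 < p) (hps : p * s < n)
    (Ω : Set (Eu n)) (hΩ : IsOpen Ω) (hK : 0 < K)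
    (hT : ∀ (u : Eu n → ℝ) (S A0 A1 : Set (Eu n)) (d M m : ℝ), Measurable u →
      MeasurableSet S → 0 < d → 0 < M → 0 < m →
      (∀ x ∈ Ω, ∀ y ∈ Ω, edist x y < ENNReal.ofReal (1/2) * EMetric.infEdist x Ωᶜ →
        |u x - u y| ≤ (dist x y / d) ^ s) →
      (∀ x ∈ Ω, ∀ y ∈ Ω, edist x y < ENNReal.ofReal (1/2) * EMetric.infEdist x Ωᶜ →
        x ∉ S → y ∉ S → u x = u y) →
      A0 ⊆ Ω → A1 ⊆ Ω → (∀ x ∈ A0, u x = 0) → (∀ x ∈ A1, u x = 1) →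
      volume S ≤ ENNReal.ofReal M → ENNReal.ofReal m ≤ volume A0 → ENNReal.ofReal m ≤ volume A1 →
      m ^ (1 / p - s / n) ≤ K * (d ^ (-s) * M ^ (1/p))) :
    ∃ ε : ℝ, 0 < ε ∧ ∀ (x z : Eu n) (ρ R : ℝ) (A0 : Set (Eu n)), 0 < R → x ∈ Ω → ρ + R ≤ dist x z →
      A0 ⊆ Ω → Disjoint A0 (connectedComponentIn (Ω \ ball z ρ) x) →
      volume (connectedComponentIn (Ω \ ball z ρ) x ∩ ball x R) ≤ volume A0 →
      ENNReal.ofReal (ε * R ^ n) ≤ volume (connectedComponentIn (Ω \ ball z ρ) x ∩ ball x R) := by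
  have hn0 : (0:ℝ) < n := by positivity
  have hne : Nonempty (Fin n) := ⟨⟨0, by omega⟩⟩
  set ω := (volume (ball (0 : Eu n) 1)).toReal with hω
  have hω' : volume (ball (0 : Eu n) 1) = ENNReal.ofReal ω :=
    (ENNReal.ofReal_toReal measure_ball_lt_top.ne).symm
  have hω0 : 0 < ω := ENNReal.toReal_pos (measure_ball_pos _ _ one_pos).ne' measure_ball_lt_top.ne
  set θ := 1 / p - s / n with hθ
  have hθ0 : 0 < θ := by
    rw [hθ, sub_pos, div_lt_div_iff₀ hn0 hp]; linarith
  set c := ((2:ℝ)⁻¹ ^ n) ^ θ / (K * 2 ^ s) with hc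
  have hc0 : 0 < c := by positivity
  set ε := min (c ^ (n / s)) (ω / 2) with hε
  have hε0 : 0 < ε := by positivity
  have hεc : K * 2 ^ s * ε ^ (s / n) ≤ ((2:ℝ)⁻¹ ^ n) ^ θ := by
    have h1 : ε ^ (s / n) ≤ (c ^ (n / s)) ^ (s / n) :=
      Real.rpow_le_rpow hε0.le (min_le_left _ _) (by positivity)
    rw [← Real.rpow_mul hc0.le, show (n:ℝ) / s * (s / n) = 1 by field_simp, Real.rpow_one] at h1
    calc _ ≤ K * 2 ^ s * c := by gcongr
      _ = _ := by rw [hc]; field_simp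
  refine ⟨ε, hε0, ?_⟩
  intro x z ρ R A0 hR hx hxz hA0 hdisj hvol
  set U := connectedComponentIn (Ω \ ball z ρ) x with hU
  have hUm : MeasurableSet U := meas_comp (hΩ.measurableSet.diff measurableSet_ball) x
  have hUΩ : U ⊆ Ω := (connectedComponentIn_subset _ _).trans diff_subset
  by_contra hcon
  rw [not_le] at hcon
  have hbz : ∀ w ∈ ball z ρ, R ≤ dist w x := by
    intro w hw
    rw [mem_ball] at hw
    have := dist_triangle x w z
    rw [dist_comm x w] at this
    linarith
  have fin : ∀ t, volume (U ∩ ball x t) ≠ ⊤ := fun t =>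
    ((measure_mono inter_subset_right).trans_lt measure_ball_lt_top).ne
  have step : ∀ t, 0 < t → t ≤ R → volume (U ∩ ball x t) ≤ ENNReal.ofReal (ε * t ^ n) →
      volume (U ∩ ball x (t/2)) ≤ ENNReal.ofReal (ε * (t/2) ^ n) := by
    intro t ht htR hle
    set m := (volume (U ∩ ball x (t/2))).toReal with hm
    have hm' : volume (U ∩ ball x (t/2)) = ENNReal.ofReal m := (ENNReal.ofReal_toReal (fin _)).symm
    rw [hm']
    apply ENNReal.ofReal_le_ofReal
    have hm0 : 0 ≤ m := ENNReal.toReal_nonneg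
    rcases hm0.eq_or_lt with h | hmp
    · rw [← h]; positivity
    set η : Eu n → ℝ := fun w => clamp ((t - dist w x) / (t/2)) with hη
    have hηm : Measurable η := clamp_meas.comp ((measurable_const.sub (measurable_id.dist measurable_const)).div_const _)
    have hη0 : ∀ w, t ≤ dist w x → η w = 0 := by
      intro w hw
      apply clamp_zero
      apply div_nonpos_of_nonpos_of_nonneg <;> linarith
    have key := hT (U.indicator η) (U ∩ ball x t) A0 (U ∩ ball x (t/2)) (t/2) (ε * t ^ n) m
      (hηm.indicator hUm) (hUm.inter measurableSet_ball) (by positivity) (by positivity) hmp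
      (fun a ha b _ hab => cut_lip hs hs1 (by positivity) η (fun _ => clamp_nonneg _) (fun _ => clamp_le _)
        (by
          intro a b
          refine (clamp_lip _ _).trans ?_
          rw [← sub_div, abs_div, abs_of_pos (show 0 < t/2 by positivity)]
          gcongr
          have := abs_dist_sub_le b a x
          rw [dist_comm b a] at this
          calc _ = |dist b x - dist a x| := by congr 1; ring
            _ ≤ _ := this)
        (fun w hw => hη0 w (htR.trans (hbz w hw))) a ha b hab)
      (by
        have h0 : ∀ a, a ∉ U ∩ ball x t → U.indicator η a = 0 := by
          intro a ha
          by_cases haU : a ∈ U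
          · rw [indicator_of_mem haU]
            apply hη0
            by_contra hlt
            exact ha ⟨haU, by rw [mem_ball]; linarith⟩
          · exact indicator_of_notMem haU _
        intro a _ b _ _ h1 h2
        rw [h0 a h1, h0 b h2])
      hA0 (inter_subset_left.trans hUΩ)
      (fun a ha => indicator_of_notMem (disjoint_left.1 hdisj ha) _)
      (by
        rintro a ⟨ha, hab⟩
        rw [indicator_of_mem ha]
        apply clamp_one
        rw [mem_ball] at hab
        rw [le_div_iff₀ (by positivity)]
        linarith)
      hle
      (by
        rw [← hm']
        refine le_trans (measure_mono ?_) hvol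
        exact inter_subset_inter_right _ (ball_subset_ball (by linarith)))
      (by rw [← hm'])
    have e1 : K * ((t/2) ^ (-s) * (ε * t ^ n) ^ (1/p)) = (K * 2 ^ s * ε ^ (s/n)) * (ε * t ^ n) ^ θ := by
      have h1 : (1:ℝ) / p = θ + s / n := by rw [hθ]; ring
      have htn : (t ^ n) ^ (s / n) = t ^ s := by
        rw [← Real.rpow_natCast, ← Real.rpow_mul ht.le]; congr 1; field_simp
      rw [h1, Real.rpow_add (by positivity), Real.mul_rpow (z := s / n) hε0.le (by positivity), htn,
        Real.rpow_neg (by positivity), Real.div_rpow ht.le (by norm_num)]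
      field_simp
    rw [e1] at key
    have key2 : m ^ θ ≤ (ε * (t/2) ^ n) ^ θ := by
      calc _ ≤ _ := key
        _ ≤ ((2:ℝ)⁻¹ ^ n) ^ θ * (ε * t ^ n) ^ θ := by gcongr
        _ = _ := by
          rw [← Real.mul_rpow (by positivity) (by positivity)]
          congr 1
          rw [div_eq_mul_inv, mul_pow]; ring
    exact (Real.rpow_le_rpow_iff hm0 (by positivity) hθ0).1 key2
  have all : ∀ i : ℕ, volume (U ∩ ball x (R * (1/2) ^ i)) ≤ ENNReal.ofReal (ε * (R * (1/2) ^ i) ^ n) := by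
    intro i
    induction i with
    | zero => simpa using hcon.le
    | succ i ih =>
      have := step (R * (1/2) ^ i) (by positivity) ?_ ih
      · rw [show R * (1/2) ^ (i+1) = R * (1/2) ^ i / 2 by rw [pow_succ]; ring]
        exact this
      · have : ((1:ℝ)/2) ^ i ≤ 1 := pow_le_one₀ (by norm_num) (by norm_num)
        nlinarith
  obtain ⟨δ, hδ, hδΩ⟩ := Metric.isOpen_iff.1 hΩ x hx
  have lim : Filter.Tendsto (fun i : ℕ => R * (1/2 : ℝ) ^ i) Filter.atTop (nhds (R * 0)) :=
    (tendsto_pow_atTop_nhds_zero_of_lt_one (by norm_num) (by norm_num)).const_mul _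
  rw [mul_zero] at lim
  obtain ⟨i, hi⟩ := (lim.eventually (gt_mem_nhds (lt_min hδ hR))).exists
  have hti : 0 < R * (1/2 : ℝ) ^ i := by positivity
  set t := R * (1/2 : ℝ) ^ i with htd
  have hsub : ball x t ⊆ U := by
    apply IsPreconnected.subset_connectedComponentIn (convex_ball x t).isPreconnected (mem_ball_self hti)
    intro w hw
    refine ⟨hδΩ (ball_subset_ball (hi.le.trans (min_le_left _ _)) hw), fun hwz => ?_⟩
    have h1 := hbz w hwz
    rw [mem_ball] at hw
    have h2 : t < R := hi.trans_le (min_le_right _ _)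
    linarith
  have h := all i
  rw [inter_eq_right.2 hsub, Measure.addHaar_ball _ _ hti.le, hω', ← ENNReal.ofReal_mul (by positivity),
    ENNReal.ofReal_le_ofReal_iff (by positivity), finrank_euclideanSpace_fin] at h
  have h2 : ε ≤ ω / 2 := min_le_right _ _
  have h3 : 0 < t ^ n := by positivity
  nlinarith

/-- A bounded `Ṁ^{s,p}_ball`-extension domain has the LLC(2) property. -/
theorem stmt0 {n : ℕ} (hn : 2 ≤ n) (s p : ℝ) (hs : s ∈ Set.Ioc (0:ℝ) 1)
    (hp : (n : ℝ) / (n + s) < p) (hp' : p < (n : ℝ) / s)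
    (Ω : Set (Eu n)) (hΩ : IsDomainEu Ω) (hbd : Bornology.IsBounded Ω)
    (hext : IsMballExtensionDomain Ω s p) :
    LLC2 Ω := by
  obtain ⟨hs0, hs1⟩ := hs
  have hn0 : (0:ℝ) < n := by positivity
  have hp0 : 0 < p := lt_trans (by positivity) hp
  have hps : p * s < n := by rwa [lt_div_iff₀ hs0] at hp'
  have hne : Nonempty (Fin n) := ⟨⟨0, by omega⟩⟩
  have hΩo := hΩ.1
  obtain ⟨K, hK, hT⟩ := testIneq hn s p hs0 hp0 hps Ω hext
  obtain ⟨ε, hε, hden⟩ := density hn s p K hs0 hs1 hp0 hps Ω hΩo hK hT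
  set ω := (volume (ball (0 : Eu n) 1)).toReal with hω
  have hω' : volume (ball (0 : Eu n) 1) = ENNReal.ofReal ω :=
    (ENNReal.ofReal_toReal measure_ball_lt_top.ne).symm
  have hω0 : 0 < ω := ENNReal.toReal_pos (measure_ball_pos _ _ one_pos).ne' measure_ball_lt_top.ne
  set θ := 1 / p - s / n with hθ
  have hθ0 : 0 < θ := by
    rw [hθ, sub_pos, div_lt_div_iff₀ hn0 hp0]; linarith
  set P := K * (ω * 2 ^ n) ^ (1/p) with hP
  have hP0 : 0 < P := by positivity
  set Q := (ε * (1/2) ^ n) ^ θ with hQ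
  have hQ0 : 0 < Q := by positivity
  set b := min (1/4) ((Q / (2 * P)) ^ (1 / (n * θ))) with hb
  have hb0 : 0 < b := by positivity
  have hb4 : b ≤ 1/4 := min_le_left _ _
  have hbP : P * b ^ (n * θ) < Q := by
    have h1 : b ^ (n * θ) ≤ ((Q / (2 * P)) ^ (1 / (n * θ))) ^ (n * θ) :=
      Real.rpow_le_rpow hb0.le (min_le_right _ _) (by positivity)
    rw [← Real.rpow_mul (by positivity), one_div_mul_cancel (by positivity), Real.rpow_one] at h1
    calc _ ≤ P * (Q / (2 * P)) := by gcongr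
      _ = Q / 2 := by field_simp
      _ < Q := by linarith
  refine ⟨b, ⟨hb0, by linarith⟩, ?_⟩
  intro z r hr
  set ρ := b * r with hρd
  have hρ : 0 < ρ := by positivity
  have h4 : 4 * ρ ≤ r := by rw [hρd]; nlinarith
  -- the asymmetric claim
  have claim : ∀ x ∈ Ω \ ball z r, ∀ y ∈ Ω \ ball z r,
      volume (connectedComponentIn (Ω \ ball z ρ) x ∩ ball x (r/2)) ≤
        volume (connectedComponentIn (Ω \ ball z ρ) y ∩ ball y (r/2)) →
      Disjoint (connectedComponentIn (Ω \ ball z ρ) y) (connectedComponentIn (Ω \ ball z ρ) x) → False := by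
    intro x hx y hy hle hdis
    have hxz : r ≤ dist x z := by simpa using hx.2
    set U := connectedComponentIn (Ω \ ball z ρ) x with hU
    set V := connectedComponentIn (Ω \ ball z ρ) y with hV
    have hUm : MeasurableSet U := meas_comp (hΩo.measurableSet.diff measurableSet_ball) x
    have hUΩ : U ⊆ Ω := (connectedComponentIn_subset _ _).trans diff_subset
    have hVΩ : V ⊆ Ω := (connectedComponentIn_subset _ _).trans diff_subset
    have hd := hden x z ρ (r/2) (V ∩ ball y (r/2)) (by positivity) hx.1 (by linarith)
      (inter_subset_left.trans hVΩ) (hdis.mono_left inter_subset_left) hle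
    set η : Eu n → ℝ := fun w => clamp ((dist w z - ρ) / ρ) with hη
    have hηm : Measurable η := clamp_meas.comp (((measurable_id.dist measurable_const).sub measurable_const).div_const _)
    have hη1 : ∀ w, 2 * ρ ≤ dist w z → η w = 1 := by
      intro w hw
      apply clamp_one
      rw [le_div_iff₀ hρ]; linarith
    have key := hT (U.indicator η) (ball z (2 * ρ)) (V ∩ ball y (r/2)) (U ∩ ball x (r/2)) ρ
      (ω * (2 * ρ) ^ n) (ε * (r/2) ^ n)
      (hηm.indicator hUm) measurableSet_ball hρ (by positivity) (by positivity)
      (fun a ha b _ hab => cut_lip hs0 hs1 hρ η (fun _ => clamp_nonneg _) (fun _ => clamp_le _)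
        (by
          intro a b
          refine (clamp_lip _ _).trans ?_
          rw [← sub_div, abs_div, abs_of_pos hρ]
          gcongr
          calc _ = |dist a z - dist b z| := by congr 1; ring
            _ ≤ _ := abs_dist_sub_le a b z)
        (by
          intro w hw
          rw [mem_ball] at hw
          apply clamp_zero
          apply div_nonpos_of_nonpos_of_nonneg <;> linarith) a ha b hab)
      (by
        intro a ha b hb hab h1 h2
        have hiff := around hn (x0 := x) hρ a ha b hb hab h1 h2
        have e1 := hη1 a (by simpa using h1)
        have e2 := hη1 b (by simpa using h2)
        by_cases haU : a ∈ U
        · rw [indicator_of_mem haU, indicator_of_mem (hiff.1 haU), e1, e2]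
        · rw [indicator_of_notMem haU, indicator_of_notMem (fun h => haU (hiff.2 h))])
      (inter_subset_left.trans hVΩ) (inter_subset_left.trans hUΩ)
      (fun a ha => indicator_of_notMem (disjoint_left.1 hdis ha.1) _)
      (by
        rintro a ⟨ha, hab⟩
        rw [indicator_of_mem ha]
        apply hη1
        rw [mem_ball] at hab
        have := dist_triangle x a z
        rw [dist_comm x a] at this
        linarith)
      (by
        rw [Measure.addHaar_ball _ _ (by positivity), hω', ← ENNReal.ofReal_mul (by positivity),
          finrank_euclideanSpace_fin, mul_comm])
      (hd.trans hle) hd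
    have e1 : (ε * (r/2) ^ n) ^ θ = Q * r ^ (n * θ) := by
      rw [hQ, show ε * (r/2) ^ n = (ε * (1/2) ^ n) * r ^ n by rw [div_pow, div_pow]; ring,
        Real.mul_rpow (by positivity) (by positivity), Real.rpow_mul hr.le, Real.rpow_natCast]
    have e2 : K * (ρ ^ (-s) * (ω * (2 * ρ) ^ n) ^ (1/p)) = P * b ^ (n * θ) * r ^ (n * θ) := by
      rw [show ω * (2 * ρ) ^ n = (ω * 2 ^ n) * ρ ^ n by rw [mul_pow]; ring,
        Real.mul_rpow (x := ω * 2 ^ n) (y := ρ ^ n) (by positivity) (by positivity), mul_assoc P, ← Real.mul_rpow hb0.le hr.le, ← hρd,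
        hP, show (n:ℝ) * θ = -s + n * (1/p) by rw [hθ]; field_simp; ring, Real.rpow_add hρ,
        Real.rpow_mul hρ.le, Real.rpow_natCast]
      ring
    rw [e1, e2] at key
    have := le_of_mul_le_mul_right key (by positivity)
    linarith
  intro x hx y hy
  by_contra hcon
  have hsubF : Ω \ ball z r ⊆ Ω \ ball z ρ :=
    diff_subset_diff_right (ball_subset_ball (by linarith))
  have hdis : Disjoint (connectedComponentIn (Ω \ ball z ρ) y) (connectedComponentIn (Ω \ ball z ρ) x) := by
    rw [disjoint_left]
    intro w hwy hwx
    apply hcon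
    rw [connectedComponentIn_eq hwx, ← connectedComponentIn_eq hwy]
    exact mem_connectedComponentIn (hsubF hy)
  rcases le_total (volume (connectedComponentIn (Ω \ ball z ρ) x ∩ ball x (r/2)))
    (volume (connectedComponentIn (Ω \ ball z ρ) y ∩ ball y (r/2))) with h | h
  · exact claim x hx y hy h hdis
  · exact claim y hy x hx h hdis.symm
end
end

section
/- Let n ≥ 2, s ∈ (0,1] and p ∈ (n/(n+s), n/s). If Ω ⊆ ℝⁿ is a bounded domain that supports a (pn/(n−ps), p)_s-Hajłasz–Sobolev–Poincaré imbedding, then Ω has the LLC(2) property. -/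
open MeasureTheory Metric Set
open scoped ENNReal

noncomputable section

theorem aux_conn {n : ℕ} (hn : 2 ≤ n) {Ω : Set (Eu n)} (hc : IsPreconnected Ω) {z : Eu n} {t : ℝ}
    (ht : 0 < t) (hb : closedBall z t ⊆ Ω) : IsPreconnected (Ω \ ball z t) := by
  have hrank : 1 < Module.rank ℝ (Eu n) := by
    rw [← Module.finrank_eq_rank, finrank_euclideanSpace_fin]
    exact_mod_cast hn
  have hS : IsPreconnected (sphere z t) := isPreconnected_sphere hrank z t
  have hSs : sphere z t ⊆ Ω \ ball z t := by
    intro w hw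
    refine ⟨hb (sphere_subset_closedBall hw), ?_⟩
    rw [mem_sphere] at hw
    simp [hw]
  have key : ∀ u v : Set (Eu n), IsOpen u → IsOpen v → Ω \ ball z t ⊆ u ∪ v →
      Ω \ ball z t ∩ (u ∩ v) = ∅ → sphere z t ⊆ u → Ω \ ball z t ⊆ u := by
    intro u v hu hv hcov hd hsu
    rw [Set.eq_empty_iff_forall_notMem] at hd
    have h := (isPreconnected_iff_subset_of_disjoint.1 hc) (u ∪ ball z t) (v \ closedBall z t)
      (hu.union isOpen_ball) (hv.sdiff isClosed_closedBall) ?_ ?_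
    · rcases h with h | h
      · intro w hw
        exact (h hw.1).resolve_right hw.2
      · exact absurd (mem_closedBall_self ht.le) (h (hb (mem_closedBall_self ht.le))).2
    · intro w hw
      rcases lt_trichotomy (dist w z) t with h1 | h1 | h1
      · exact Or.inl (Or.inr h1)
      · exact Or.inl (Or.inl (hsu h1))
      · have : w ∉ ball z t := by simp [h1.le]
        rcases hcov ⟨hw, this⟩ with h2 | h2
        · exact Or.inl (Or.inl h2)
        · exact Or.inr ⟨h2, by simp [h1]⟩
    · rw [Set.eq_empty_iff_forall_notMem]
      rintro w ⟨hw, h1, h2, h3⟩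
      have h4 : w ∉ ball z t := fun h => h3 (ball_subset_closedBall h)
      exact hd w ⟨⟨hw, h4⟩, h1.resolve_right h4, h2⟩
  rw [isPreconnected_iff_subset_of_disjoint]
  intro u v hu hv hcov hd
  have hd' : sphere z t ∩ (u ∩ v) = ∅ :=
    Set.subset_empty_iff.1 (hd ▸ Set.inter_subset_inter_left _ hSs)
  rcases (isPreconnected_iff_subset_of_disjoint.1 hS) u v hu hv (hSs.trans hcov) hd' with h | h
  · exact Or.inl (key u v hu hv hcov hd h)
  · exact Or.inr (key v u hv hu (by rwa [Set.union_comm]) (by rwa [Set.inter_comm v u]) h)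

theorem aux_meas {n : ℕ} {Ω : Set (Eu n)} (ho : IsOpen Ω) (z x : Eu n) (t : ℝ) :
    MeasurableSet (connectedComponentIn (Ω \ ball z t) x) := by
  set F := Ω \ ball z t with hF
  have hFm : MeasurableSet F := ho.measurableSet.diff measurableSet_ball
  by_cases hx : x ∈ F
  · have : connectedComponentIn F x = closure (connectedComponentIn F x) ∩ F := by
      apply Set.Subset.antisymm
      · exact Set.subset_inter subset_closure (connectedComponentIn_subset F x)
      · have hpre : IsPreconnected (closure (connectedComponentIn F x) ∩ F) :=
          isPreconnected_connectedComponentIn.subset_closure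
            (Set.subset_inter subset_closure (connectedComponentIn_subset F x))
            Set.inter_subset_left
        exact hpre.subset_connectedComponentIn
          ⟨subset_closure (mem_connectedComponentIn hx), hx⟩ Set.inter_subset_right
    rw [this]
    exact isClosed_closure.measurableSet.inter hFm
  · rw [connectedComponentIn_eq_empty hx]; exact MeasurableSet.empty

/-- Stampacchia-type iteration. -/
theorem aux_stamp (h : ℝ → ℝ) (α s K t d ε : ℝ) (hα : 0 < α) (hs : 0 < s) (hK : 0 < K)
    (hd : 0 < d) (hε : 0 < ε)
    (H : ∀ ρ ρ', t ≤ ρ → ρ < ρ' → ρ' ≤ t + d →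
      h ρ' ^ α * (ρ' - ρ) ^ s ≤ K * h ρ ^ (α + s))
    (hpos : ∀ ρ, t ≤ ρ → ρ ≤ t + d → ε ≤ h ρ) :
    (2:ℝ) ^ (-α) < K * (2 * h t / d) ^ s := by
  by_contra! hcon
  have h0 : 0 < h t := hε.trans_le (hpos t le_rfl (by linarith))
  set r : ℕ → ℝ := fun j => t + d * (1 - (1/2)^j) with hr
  have hp1 : ∀ j : ℕ, (0:ℝ) < (1/2)^j := fun j => by positivity
  have hp2 : ∀ j : ℕ, ((1:ℝ)/2)^j ≤ 1 := fun j => pow_le_one₀ (by norm_num) (by norm_num)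
  have hr1 : ∀ j, t ≤ r j := fun j => by
    have := mul_nonneg hd.le (sub_nonneg.2 (hp2 j)); simp only [hr]; linarith
  have hr2 : ∀ j, r j ≤ t + d := fun j => by
    have := mul_pos hd (hp1 j); simp only [hr]; nlinarith
  have hrd : ∀ j, r (j+1) - r j = d * (1/2)^(j+1) := fun j => by simp only [hr]; ring
  have ind : ∀ j : ℕ, h (r j) ≤ h t * (1/2)^j := by
    intro j
    induction j with
    | zero => simp [hr]
    | succ j ih =>
      have hdp : 0 < d * (1/2:ℝ)^(j+1) := mul_pos hd (hp1 _)
      have h1 := H (r j) (r (j+1)) (hr1 j) (by linarith [hrd j]) (hr2 _)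
      rw [hrd] at h1
      have hj0 : 0 < h (r j) := hε.trans_le (hpos _ (hr1 j) (hr2 j))
      have hj1 : 0 < h (r (j+1)) := hε.trans_le (hpos _ (hr1 _) (hr2 _))
      have hb : 0 < h t * (1/2)^j := mul_pos h0 (hp1 j)
      have h2 : h (r j) ^ (α + s) ≤ (h t * (1/2)^j) ^ (α + s) :=
        Real.rpow_le_rpow hj0.le ih (by linarith)
      have h3 : h (r (j+1)) ^ α * (d * (1/2)^(j+1)) ^ s ≤
          (h t * (1/2)^(j+1)) ^ α * (d * (1/2)^(j+1)) ^ s := by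
        calc _ ≤ K * h (r j) ^ (α + s) := h1
          _ ≤ K * (h t * (1/2)^j) ^ (α + s) := by gcongr
          _ = (h t * (1/2)^j) ^ α * (K * (2 * h t / d) ^ s) * (d * (1/2)^(j+1)) ^ s := by
            have e : h t * (1/2)^j = (2 * h t / d) * (d * (1/2)^(j+1)) := by
              field_simp; ring
            rw [Real.rpow_add hb]
            nth_rewrite 2 [e]
            rw [Real.mul_rpow (by positivity) hdp.le]
            ring
          _ ≤ (h t * (1/2)^j) ^ α * (2:ℝ) ^ (-α) * (d * (1/2)^(j+1)) ^ s := by gcongr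
          _ = _ := by
            congr 1
            rw [Real.rpow_neg (by norm_num), ← Real.inv_rpow (by norm_num),
              ← Real.mul_rpow hb.le (by norm_num)]
            congr 1
            ring
      have h4 := le_of_mul_le_mul_right h3 (Real.rpow_pos_of_pos hdp s)
      exact (Real.rpow_le_rpow_iff hj1.le (mul_pos h0 (hp1 _)).le hα).1 h4
  obtain ⟨j, hj⟩ := exists_pow_lt_of_lt_one (div_pos hε h0) (by norm_num : (1/2:ℝ) < 1)
  have h5 := hpos _ (hr1 j) (hr2 j)
  have h6 := ind j
  rw [lt_div_iff₀ h0] at hj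
  linarith

theorem aux_key {n : ℕ} {s p : ℝ} (hp : 0 < p) (hq : 0 < p * n / (n - p * s))
    {Ω : Set (Eu n)} {C : ℝ} (hC : 0 < C)
    (hsp : ∀ u : Eu n → ℝ, MemMball Ω s p u →
    eLpNorm (fun x => u x - ⨍ y in Ω, u y)
        (ENNReal.ofReal (p * n / (n - p * s))) (volume.restrict Ω)
      ≤ ENNReal.ofReal C * ballNorm Ω s p u)
    (u : Eu n → ℝ) (hu : Measurable u) (K : ℝ) (hK : 0 < K) (A : Set (Eu n))
    (hA : MeasurableSet A) (hAf : volume A ≠ ∞)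
    (hg : A.indicator (fun _ => K) ∈ DBall Ω s (1/2) u)
    (E0 E1 : Set (Eu n)) (hE0 : MeasurableSet E0) (hE1 : MeasurableSet E1)
    (hE0s : E0 ⊆ Ω) (hE1s : E1 ⊆ Ω)
    (hu0 : ∀ x ∈ E0, u x = 0) (hu1 : ∀ x ∈ E1, u x = 1) (hE : volume E1 ≤ volume E0) :
    (volume E1).toReal ^ (1 / (p * n / (n - p * s))) ≤
      2 * C * K * (volume A).toReal ^ (1 / p) := by
  set q := p * n / (n - p * s) with hqd
  set c := ⨍ y in Ω, u y with hc
  have hpp : ENNReal.ofReal p ≠ 0 := by simpa using hp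
  have hqq : ENNReal.ofReal q ≠ 0 := by simpa using hq
  have hN : ballNorm Ω s p u ≤ ENNReal.ofReal K * volume A ^ (1/p) := by
    calc ballNorm Ω s p u ≤ eLpNorm (A.indicator (fun _ => K)) (ENNReal.ofReal p)
          (volume.restrict Ω) := iInf₂_le _ hg
      _ = ‖K‖ₑ * (volume.restrict Ω) A ^ (1/p) := by
        rw [eLpNorm_indicator_const hA hpp ENNReal.ofReal_ne_top, ENNReal.toReal_ofReal hp.le]
      _ ≤ _ := by
        rw [Real.enorm_eq_ofReal hK.le]
        gcongr
        exact Measure.restrict_le_self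
  have hAf' : volume A ^ (1/p) ≠ ∞ := ENNReal.rpow_ne_top_of_nonneg (by positivity) hAf
  have hNf : ENNReal.ofReal K * volume A ^ (1/p) ≠ ∞ := ENNReal.mul_ne_top ENNReal.ofReal_ne_top hAf'
  have hmain := (hsp u ⟨hu, hN.trans_lt hNf.lt_top⟩).trans (mul_le_mul_right hN _)
  have low : ∀ E : Set (Eu n), MeasurableSet E → E ⊆ Ω → (∀ x ∈ E, 1/2 ≤ |u x - c|) →
      ENNReal.ofReal (1/2) * volume E ^ (1/q) ≤
        eLpNorm (fun x => u x - c) (ENNReal.ofReal q) (volume.restrict Ω) := by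
    intro E hE hEs hh
    calc _ = eLpNorm (E.indicator (fun _ => (1/2:ℝ))) (ENNReal.ofReal q)
          (volume.restrict Ω) := by
          rw [eLpNorm_indicator_const hE hqq ENNReal.ofReal_ne_top, ENNReal.toReal_ofReal hq.le,
            Measure.restrict_apply hE, Set.inter_eq_left.2 hEs, Real.enorm_eq_ofReal (by norm_num)]
      _ ≤ _ := by
        apply eLpNorm_mono
        intro x
        by_cases hx : x ∈ E
        · simp only [Set.indicator_of_mem hx, Real.norm_eq_abs]
          rw [abs_of_pos (by norm_num : (0:ℝ) < 1/2)]
          exact hh x hx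
        · simp [Set.indicator_of_notMem hx]
  have hlow : ENNReal.ofReal (1/2) * volume E1 ^ (1/q) ≤
        eLpNorm (fun x => u x - c) (ENNReal.ofReal q) (volume.restrict Ω) := by
    by_cases h : c ≤ 1/2
    · apply low E1 hE1 hE1s
      intro x hx
      rw [hu1 x hx, abs_of_nonneg (by linarith)]; linarith
    · push Not at h
      refine le_trans ?_ (low E0 hE0 hE0s ?_)
      · gcongr
      · intro x hx
        rw [hu0 x hx, zero_sub, abs_neg]
        exact h.le.trans (le_abs_self c)
  have hfin := hlow.trans hmain
  have := ENNReal.toReal_mono (ENNReal.mul_ne_top ENNReal.ofReal_ne_top hNf) hfin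
  simp only [ENNReal.toReal_mul, ← ENNReal.toReal_rpow, ENNReal.toReal_ofReal hC.le,
    ENNReal.toReal_ofReal hK.le, ENNReal.toReal_ofReal (by norm_num : (0:ℝ) ≤ 1/2)] at this
  linarith

theorem aux_seg {n : ℕ} {Ω : Set (Eu n)} {x y : Eu n}
    (h : edist x y < ENNReal.ofReal (1/2) * EMetric.infEdist x Ωᶜ) :
    closedBall x (2 * dist x y) ⊆ Ω := by
  intro w hw
  by_contra hwn
  have h1 : EMetric.infEdist x Ωᶜ ≤ edist x w := infEDist_le_edist_of_mem hwn
  have h2 : edist x y < ENNReal.ofReal (1/2) * edist x w :=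
    h.trans_le (mul_le_mul_right h1 _)
  rw [edist_dist, edist_dist, ← ENNReal.ofReal_mul (by norm_num),
    ENNReal.ofReal_lt_ofReal_iff_of_nonneg dist_nonneg] at h2
  rw [mem_closedBall, dist_comm] at hw
  linarith

/-- Radial cutoff profile. -/
def cutP {n : ℕ} (z : Eu n) (ρ δ : ℝ) (w : Eu n) : ℝ := max 0 (min 1 ((dist w z - ρ) / δ))

theorem cutP_zero {n : ℕ} {z : Eu n} {ρ δ : ℝ} (hδ : 0 < δ) {w : Eu n} (h : dist w z ≤ ρ) :
    cutP z ρ δ w = 0 := by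
  have : (dist w z - ρ) / δ ≤ 0 := div_nonpos_of_nonpos_of_nonneg (by linarith) hδ.le
  exact max_eq_left ((min_le_right _ _).trans this)

theorem cutP_one {n : ℕ} {z : Eu n} {ρ δ : ℝ} (hδ : 0 < δ) {w : Eu n} (h : ρ + δ ≤ dist w z) :
    cutP z ρ δ w = 1 := by
  have : 1 ≤ (dist w z - ρ) / δ := by rw [le_div_iff₀ hδ]; linarith
  rw [cutP, min_eq_left this]; norm_num

theorem cutP_nonneg {n : ℕ} (z : Eu n) (ρ δ : ℝ) (w : Eu n) : 0 ≤ cutP z ρ δ w := le_max_left _ _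

theorem cutP_le_one {n : ℕ} (z : Eu n) (ρ δ : ℝ) (w : Eu n) : cutP z ρ δ w ≤ 1 :=
  max_le zero_le_one (min_le_left _ _)

theorem cutP_lip {n : ℕ} (z : Eu n) (ρ : ℝ) {δ : ℝ} (hδ : 0 < δ) (v w : Eu n) :
    cutP z ρ δ v - cutP z ρ δ w ≤ dist v w / δ := by
  have h1 : (dist v z - ρ) / δ ≤ (dist w z - ρ) / δ + dist v w / δ := by
    rw [← add_div]
    gcongr
    linarith [dist_triangle v w z]
  have h0 : 0 ≤ dist v w / δ := by positivity
  have h2 : cutP z ρ δ v ≤ cutP z ρ δ w + dist v w / δ := by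
    apply max_le
    · exact add_nonneg (cutP_nonneg _ _ _ _) h0
    · have h3 : min 1 ((dist w z - ρ) / δ) ≤ cutP z ρ δ w := le_max_right _ _
      rcases le_total 1 ((dist w z - ρ) / δ) with h4 | h4
      · rw [min_eq_left h4] at h3
        exact (min_le_left _ _).trans (by linarith)
      · rw [min_eq_right h4] at h3
        exact (min_le_right _ _).trans (by linarith)
  linarith

theorem aux_rpow {a b s : ℝ} (hs : 0 < s) (hs1 : s ≤ 1) (h1 : b ≤ 1) (ha : 0 ≤ a) (h2 : b ≤ a) :
    b ≤ a ^ s := by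
  rcases le_total a 1 with h | h
  · exact h2.trans (Real.self_le_rpow_of_le_one ha h hs1)
  · exact h1.trans (Real.one_le_rpow h hs.le)

theorem aux_cross {n : ℕ} {Ω : Set (Eu n)} {z x₀ x y : Eu n} {t : ℝ}
    (hx : x ∈ connectedComponentIn (Ω \ ball z t) x₀)
    (hy : y ∉ connectedComponentIn (Ω \ ball z t) x₀)
    (hseg : segment ℝ x y ⊆ Ω) : ∃ w ∈ segment ℝ x y, dist w z < t := by
  by_contra! hcon
  apply hy
  have hsub : segment ℝ x y ⊆ Ω \ ball z t := fun w hw =>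
    ⟨hseg hw, by simpa using hcon w hw⟩
  have h1 := (convex_segment (𝕜 := ℝ) x y).isPreconnected.subset_connectedComponentIn
    (left_mem_segment ℝ x y) hsub
  rw [connectedComponentIn_eq hx]
  exact h1 (right_mem_segment ℝ x y)

theorem aux_seg_dist {n : ℕ} {x y w : Eu n} (hw : w ∈ segment ℝ x y) : dist x w ≤ dist x y := by
  have : segment ℝ x y ⊆ closedBall x (dist x y) :=
    (convex_closedBall x _).segment_subset (mem_closedBall_self dist_nonneg)
      (by simp [dist_comm])
  have := this hw
  rwa [mem_closedBall, dist_comm] at this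

theorem aux_segsub {n : ℕ} {Ω : Set (Eu n)} {x y : Eu n} (h : closedBall x (2 * dist x y) ⊆ Ω) :
    segment ℝ x y ⊆ Ω := by
  intro w hw
  apply h
  have := aux_seg_dist hw
  rw [mem_closedBall, dist_comm]
  linarith [dist_nonneg (x := x) (y := y)]

/-- Half of the Lipschitz estimate. -/
theorem aux_half {n : ℕ} {Ω : Set (Eu n)} {z x₀ x y : Eu n} {t ρ δ s : ℝ}
    (hs : 0 < s) (hs1 : s ≤ 1) (hδ : 0 < δ) (ht : t ≤ ρ) (hseg : segment ℝ x y ⊆ Ω) :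
    (connectedComponentIn (Ω \ ball z t) x₀).indicator (cutP z ρ δ) x -
      (connectedComponentIn (Ω \ ball z t) x₀).indicator (cutP z ρ δ) y ≤ (dist x y / δ) ^ s := by
  set U := connectedComponentIn (Ω \ ball z t) x₀ with hU
  have hnn : 0 ≤ U.indicator (cutP z ρ δ) y :=
    Set.indicator_nonneg (fun w _ => cutP_nonneg z ρ δ w) y
  have hd0 : 0 ≤ dist x y / δ := by positivity
  by_cases hx : x ∈ U
  · rw [Set.indicator_of_mem hx]
    apply aux_rpow hs hs1 _ hd0
    · by_cases hy : y ∈ U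
      · rw [Set.indicator_of_mem hy]
        exact cutP_lip z ρ hδ x y
      · rw [Set.indicator_of_notMem hy]
        obtain ⟨w, hw, hwz⟩ := aux_cross hx hy hseg
        have h1 := cutP_lip z ρ hδ x w
        rw [cutP_zero hδ (hwz.le.trans ht)] at h1
        refine h1.trans ?_
        gcongr
        exact aux_seg_dist hw
    · linarith [cutP_le_one z ρ δ x]
  · rw [Set.indicator_of_notMem hx]
    have := Real.rpow_nonneg hd0 s
    linarith

theorem aux_cap {n : ℕ} {s p : ℝ} (hs : 0 < s) (hs1 : s ≤ 1)
    (hp : 0 < p) (hq : 0 < p * n / (n - p * s))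
    {Ω : Set (Eu n)} (ho : IsOpen Ω) {C : ℝ} (hC : 0 < C)
    (hsp : ∀ u : Eu n → ℝ, MemMball Ω s p u →
    eLpNorm (fun x => u x - ⨍ y in Ω, u y)
        (ENNReal.ofReal (p * n / (n - p * s))) (volume.restrict Ω)
      ≤ ENNReal.ofReal C * ballNorm Ω s p u)
    {z x₀ : Eu n} {t ρ δ : ℝ} (hδ : 0 < δ) (ht : t ≤ ρ)
    {U : Set (Eu n)} (hU : U = connectedComponentIn (Ω \ ball z t) x₀)
    (hvol : volume U ≤ volume (Ω \ U))
    {A : Set (Eu n)} (hA : MeasurableSet A) (hAf : volume A ≠ ∞)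
    (hAu : ∀ x ∈ Ω, ∀ y ∈ Ω, closedBall x (2 * dist x y) ⊆ Ω → x ∉ A → y ∉ A →
      U.indicator (cutP z ρ δ) x = U.indicator (cutP z ρ δ) y) :
    (volume (U \ ball z (ρ + δ))).toReal ^ (1 / (p * n / (n - p * s))) * δ ^ s ≤
      2 * C * (volume A).toReal ^ (1 / p) := by
  have hUm : MeasurableSet U := hU ▸ aux_meas ho z x₀ t
  have hUs : U ⊆ Ω := hU ▸ (connectedComponentIn_subset _ _).trans Set.diff_subset
  have hδs : 0 < δ ^ s := Real.rpow_pos_of_pos hδ s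
  have hcont : Measurable (cutP z ρ δ) := by
    unfold cutP
    fun_prop
  have key := aux_key hp hq hC hsp (U.indicator (cutP z ρ δ)) (hcont.indicator hUm)
    (δ ^ s)⁻¹ (by positivity) A hA hAf ?_ (Ω \ U) (U \ ball z (ρ + δ))
    (ho.measurableSet.diff hUm) (hUm.diff measurableSet_ball) Set.diff_subset
    (Set.diff_subset.trans hUs) (fun x hx => Set.indicator_of_notMem hx.2 _)
    (fun x hx => by
      rw [Set.indicator_of_mem hx.1]
      exact cutP_one hδ (by simpa using hx.2))
    ((measure_mono Set.diff_subset).trans hvol)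
  · calc _ ≤ 2 * C * (δ ^ s)⁻¹ * (volume A).toReal ^ (1 / p) * δ ^ s := by gcongr
      _ = _ := by field_simp
  · refine ⟨measurable_const.indicator hA, fun x => Set.indicator_nonneg (fun _ _ => by positivity) x,
      ∅, Set.empty_subset _, measure_empty, ?_⟩
    rintro x ⟨hx, -⟩ y ⟨hy, -⟩ hxy
    have hb := aux_seg hxy
    have hseg := aux_segsub hb
    have hK : 0 ≤ (δ ^ s)⁻¹ := by positivity
    have hnn : ∀ w, 0 ≤ A.indicator (fun _ => (δ ^ s)⁻¹) w := fun w =>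
      Set.indicator_nonneg (fun _ _ => hK) w
    by_cases hAA : x ∉ A ∧ y ∉ A
    · rw [hAu x hx y hy hb hAA.1 hAA.2, sub_self, abs_zero]
      exact mul_nonneg (Real.rpow_nonneg dist_nonneg _) (add_nonneg (hnn _) (hnn _))
    · have h1 : (δ ^ s)⁻¹ ≤ A.indicator (fun _ => (δ ^ s)⁻¹) x + A.indicator (fun _ => (δ ^ s)⁻¹) y := by
        by_cases hxA : x ∈ A
        · have := hnn y
          rw [Set.indicator_of_mem hxA]; linarith
        · have hyA : y ∈ A := by tauto
          have := hnn x
          rw [Set.indicator_of_mem hyA]; linarith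
      have h2 : |U.indicator (cutP z ρ δ) x - U.indicator (cutP z ρ δ) y| ≤ (dist x y / δ) ^ s := by
        rw [hU, abs_le']
        refine ⟨aux_half hs hs1 hδ ht hseg, ?_⟩
        rw [neg_sub, dist_comm]
        exact aux_half hs hs1 hδ ht (segment_symm ℝ x y ▸ hseg)
      refine h2.trans ?_
      rw [Real.div_rpow dist_nonneg hδ.le, div_eq_mul_inv]
      gcongr

theorem aux_main {n : ℕ} (hn : 2 ≤ n) {s p : ℝ} (hs : 0 < s) (hs1 : s ≤ 1)
    (hp : 0 < p) (hps : p * s < n)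
    {Ω : Set (Eu n)} (ho : IsOpen Ω) (hbd : Bornology.IsBounded Ω) {C : ℝ} (hC : 0 < C)
    (hsp : ∀ u : Eu n → ℝ, MemMball Ω s p u →
    eLpNorm (fun x => u x - ⨍ y in Ω, u y)
        (ENNReal.ofReal (p * n / (n - p * s))) (volume.restrict Ω)
      ≤ ENNReal.ofReal C * ballNorm Ω s p u)
    {α W B : ℝ} (hα : α = (n - p * s) / p)
    (hW : W = (volume (ball (0 : Eu n) 1)).toReal ^ (1 / (n:ℝ)))
    (hB : B = (2 * C * (3 * W) ^ (α + s)) ^ (1 / α))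
    {z x₀ : Eu n} {t r : ℝ} (ht0 : 0 < t) (htr : 4 * t ≤ r) (hx₀ : x₀ ∈ Ω \ ball z r)
    (hball : ¬ closedBall z t ⊆ Ω)
    {U : Set (Eu n)} (hU : U = connectedComponentIn (Ω \ ball z t) x₀)
    (hvol : volume U ≤ volume (Ω \ U)) :
    (2:ℝ) ^ (-α) < 2 * C * (8 * B * (t / r)) ^ s := by
  have hn0 : (0:ℝ) < n := by exact_mod_cast (by omega : 0 < n)
  have hnps : 0 < n - p * s := by linarith
  have hα0 : 0 < α := by rw [hα]; positivity
  have hq : 0 < p * n / (n - p * s) := by positivity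
  have hr0 : 0 < r := by linarith
  have hUm : MeasurableSet U := hU ▸ aux_meas ho z x₀ t
  have hUs : U ⊆ Ω := hU ▸ (connectedComponentIn_subset _ _).trans Set.diff_subset
  have hΩf : volume Ω ≠ ∞ := hbd.measure_lt_top.ne
  have hfin : ∀ ρ, volume (U \ ball z ρ) ≠ ∞ := fun ρ =>
    measure_ne_top_of_subset (Set.diff_subset.trans hUs) hΩf
  set h : ℝ → ℝ := fun ρ => (volume (U \ ball z ρ)).toReal ^ (1 / (n:ℝ)) with hh
  have hh0 : ∀ ρ, 0 ≤ h ρ := fun ρ => Real.rpow_nonneg ENNReal.toReal_nonneg _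
  have e1 : ∀ ρ, (volume (U \ ball z ρ)).toReal ^ (1 / (p * n / (n - p * s))) = h ρ ^ α := by
    intro ρ
    rw [hh, ← Real.rpow_mul ENNReal.toReal_nonneg, hα]
    congr 1
    field_simp
  have hαs : α + s = n / p := by rw [hα]; field_simp; ring
  have e2 : ∀ ρ, (volume (U \ ball z ρ)).toReal ^ (1 / p) = h ρ ^ (α + s) := by
    intro ρ
    rw [hh, ← Real.rpow_mul ENNReal.toReal_nonneg, hαs]
    congr 1
    field_simp
  have hW0 : 0 < W := by
    rw [hW]
    apply Real.rpow_pos_of_pos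
    exact ENNReal.toReal_pos (measure_ball_pos _ _ one_pos).ne' measure_ball_lt_top.ne
  have hB0 : 0 < B := by rw [hB]; positivity
  -- the iteration inequality
  have H : ∀ ρ ρ', 2 * t ≤ ρ → ρ < ρ' → ρ' ≤ 2 * t + r / 4 →
      h ρ' ^ α * (ρ' - ρ) ^ s ≤ 2 * C * h ρ ^ (α + s) := by
    intro ρ ρ' h1 h2 _
    have := aux_cap hs hs1 hp hq ho hC hsp (sub_pos.2 h2) (by linarith : t ≤ ρ) hU hvol
      (A := U \ ball z ρ) (hUm.diff measurableSet_ball) (hfin ρ) ?_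
    · rwa [add_sub_cancel, e1, e2] at this
    · have hz : ∀ x, x ∉ U \ ball z ρ → U.indicator (cutP z ρ (ρ' - ρ)) x = 0 := by
        intro x hx
        by_cases hxU : x ∈ U
        · rw [Set.indicator_of_mem hxU]
          apply cutP_zero (sub_pos.2 h2)
          by_contra! hcon
          exact hx ⟨hxU, by simp [hcon.le]⟩
        · exact Set.indicator_of_notMem hxU _
      intro x _ y _ _ hx hy
      rw [hz x hx, hz y hy]
  -- the capacity estimate
  have H2 : h (2 * t) ≤ B * t := by
    have hcr : ∀ x ∈ U, ∀ y ∉ U, segment ℝ x y ⊆ Ω →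
        (∀ w ∈ segment ℝ x y, closedBall w (dist x y) ⊆ Ω) →
        x ∈ ball z (3 * t) := by
      intro x hx y hy hseg hcl
      rw [hU] at hx hy
      obtain ⟨w, hw, hwz⟩ := aux_cross hx hy hseg
      have hlt : dist x y < 2 * t := by
        by_contra! hge
        apply hball
        refine subset_trans ?_ (hcl w hw)
        apply closedBall_subset_closedBall'
        rw [dist_comm] at hwz
        linarith
      have := aux_seg_dist hw
      rw [mem_ball]
      linarith [dist_triangle x w z]
    have := aux_cap hs hs1 hp hq ho hC hsp ht0 (le_refl t) hU hvol
      (A := ball z (3 * t)) measurableSet_ball measure_ball_lt_top.ne ?_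
    · have hvb : (volume (ball z (3 * t))).toReal ^ (1 / p) = (3 * W * t) ^ (α + s) := by
        rw [Measure.addHaar_ball_of_pos volume z (by positivity : 0 < 3 * t), ENNReal.toReal_mul,
          ENNReal.toReal_ofReal (by positivity), finrank_euclideanSpace_fin, hW, hαs,
          mul_right_comm, Real.mul_rpow (by positivity) (by positivity),
          Real.mul_rpow (by positivity) (by positivity),
          ← Real.rpow_mul ENNReal.toReal_nonneg, ← Real.rpow_natCast,
          ← Real.rpow_mul (by positivity)]
        congr 2 <;> field_simp
      rw [e1, hvb, ← two_mul, Real.mul_rpow (by positivity) ht0.le, Real.rpow_add ht0, ← mul_assoc,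
        ← mul_assoc] at this
      have h3 := le_of_mul_le_mul_right this (Real.rpow_pos_of_pos ht0 s)
      have h4 : h (2 * t) ^ α ≤ (B * t) ^ α := by
        have hBα : B ^ α = 2 * C * (3 * W) ^ (α + s) := by
          rw [hB, ← Real.rpow_mul (by positivity), one_div_mul_cancel hα0.ne', Real.rpow_one]
        rw [Real.mul_rpow hB0.le ht0.le, hBα]
        exact h3
      exact (Real.rpow_le_rpow_iff (hh0 _) (by positivity) hα0).1 h4
    · intro x hx y hy hcl hxA hyA
      have hseg := aux_segsub hcl
      have hcl' : ∀ w ∈ segment ℝ x y, closedBall w (dist x y) ⊆ Ω := by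
        intro w hw
        refine subset_trans (closedBall_subset_closedBall' ?_) hcl
        have := aux_seg_dist hw
        rw [dist_comm w x]; linarith
      have h1 : ∀ x, x ∉ ball z (3 * t) → cutP z t t x = 1 := by
        intro x hx
        apply cutP_one ht0
        have : 3 * t ≤ dist x z := by simpa using hx
        linarith
      by_cases hxU : x ∈ U
      · by_cases hyU : y ∈ U
        · rw [Set.indicator_of_mem hxU, Set.indicator_of_mem hyU, h1 x hxA, h1 y hyA]
        · exact absurd (hcr x hxU y hyU hseg hcl') hxA
      · by_cases hyU : y ∈ U
        · refine absurd (hcr y hyU x hxU (segment_symm ℝ x y ▸ hseg) ?_) hyA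
          rw [segment_symm, dist_comm]; exact hcl'
        · rw [Set.indicator_of_notMem hxU, Set.indicator_of_notMem hyU]
  -- positivity
  have hxr : r ≤ dist x₀ z := by simpa using hx₀.2
  obtain ⟨ε, hε, hεΩ⟩ := Metric.isOpen_iff.1 ho x₀ hx₀.1
  set η := min ε (r / 4) with hη
  have hη0 : 0 < η := lt_min hε (by linarith)
  have hbig : ∀ w ∈ ball x₀ η, 2 * t + r / 4 ≤ dist w z := by
    intro w hw
    rw [mem_ball] at hw
    have : η ≤ r / 4 := min_le_right _ _
    have := dist_triangle x₀ w z
    rw [dist_comm x₀ w] at this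
    linarith
  have hbU : ball x₀ η ⊆ U := by
    rw [hU]
    apply (convex_ball x₀ η).isPreconnected.subset_connectedComponentIn (mem_ball_self hη0)
    intro w hw
    refine ⟨hεΩ (ball_subset_ball (min_le_left _ _) hw), ?_⟩
    have := hbig w hw
    simp only [mem_ball, not_lt]
    linarith
  have hpos : ∀ ρ, 2 * t ≤ ρ → ρ ≤ 2 * t + r / 4 →
      (volume (ball x₀ η)).toReal ^ (1 / (n:ℝ)) ≤ h ρ := by
    intro ρ _ h2
    apply Real.rpow_le_rpow ENNReal.toReal_nonneg _ (by positivity)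
    apply ENNReal.toReal_mono (hfin ρ)
    apply measure_mono
    intro w hw
    refine ⟨hbU hw, ?_⟩
    have := hbig w hw
    simp only [mem_ball, not_lt]
    linarith
  have hfinal := aux_stamp h α s (2 * C) (2 * t) (r / 4) _ hα0 hs (by positivity) (by linarith)
    (Real.rpow_pos_of_pos (ENNReal.toReal_pos (measure_ball_pos _ _ hη0).ne'
      measure_ball_lt_top.ne) _) H hpos
  refine hfinal.trans_le ?_
  have : 2 * h (2 * t) / (r / 4) ≤ 8 * B * (t / r) := by
    rw [div_le_iff₀ (by linarith)]
    have : 8 * B * (t / r) * (r / 4) = 2 * (B * t) := by field_simp; ring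
    linarith
  have h0 : 0 ≤ 2 * h (2 * t) / (r / 4) := by
    have := hh0 (2 * t)
    positivity
  gcongr

/-- A bounded domain supporting a `(pn/(n-ps), p)_s`-HSP imbedding has the
LLC(2) property. -/
theorem stmt1 {n : ℕ} (hn : 2 ≤ n) (s p : ℝ) (hs : s ∈ Set.Ioc (0:ℝ) 1)
    (hp : (n : ℝ) / (n + s) < p) (hp' : p < (n : ℝ) / s)
    (Ω : Set (Eu n)) (hΩ : IsDomainEu Ω) (hbd : Bornology.IsBounded Ω)
    (hsp : SupportsHSP Ω s p) :
    LLC2 Ω := by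
  obtain ⟨hs0, hs1⟩ := hs
  obtain ⟨ho, hconn⟩ := hΩ
  obtain ⟨C, hC, hsp⟩ := hsp
  have hn0 : (0:ℝ) < n := by exact_mod_cast (by omega : 0 < n)
  have hp0 : 0 < p := lt_trans (by positivity) hp
  have hps : p * s < n := (lt_div_iff₀ hs0).1 hp'
  set α : ℝ := (n - p * s) / p with hα
  set W : ℝ := (volume (ball (0 : Eu n) 1)).toReal ^ (1 / (n:ℝ)) with hW
  set B : ℝ := (2 * C * (3 * W) ^ (α + s)) ^ (1 / α) with hB
  have hW0 : 0 < W := by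
    rw [hW]
    apply Real.rpow_pos_of_pos
    exact ENNReal.toReal_pos (measure_ball_pos _ _ one_pos).ne' measure_ball_lt_top.ne
  have hB0 : 0 < B := by rw [hB]; positivity
  set b₀ : ℝ := ((2:ℝ) ^ (-α) / (2 * C)) ^ (1 / s) / (8 * B) with hb₀
  have hb₀0 : 0 < b₀ := by rw [hb₀]; positivity
  have hb0 : 0 < min (1/4) b₀ := lt_min (by norm_num) hb₀0
  have hb4 : min (1/4) b₀ ≤ 1/4 := min_le_left _ _
  refine ⟨min (1/4) b₀, ⟨hb0, by linarith⟩, ?_⟩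
  intro z r hr x hx y hy
  set b := min (1/4) b₀ with hb
  have ht0 : 0 < b * r := mul_pos hb0 hr
  have htr : 4 * (b * r) ≤ r := by nlinarith
  have hsub : ball z (b * r) ⊆ ball z r := ball_subset_ball (by nlinarith)
  have hx' : x ∈ Ω \ ball z (b * r) := ⟨hx.1, fun h => hx.2 (hsub h)⟩
  have hy' : y ∈ Ω \ ball z (b * r) := ⟨hy.1, fun h => hy.2 (hsub h)⟩
  by_contra hne
  have hball : ¬ closedBall z (b * r) ⊆ Ω := by
    intro hcl
    have := (aux_conn hn hconn.isPreconnected ht0 hcl).connectedComponentIn hx'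
    rw [this] at hne
    exact hne hy'
  have contra : ∀ x₀ ∈ Ω \ ball z r, ∀ U, U = connectedComponentIn (Ω \ ball z (b * r)) x₀ →
      volume U ≤ volume (Ω \ U) → False := by
    intro x₀ hx₀ U hU hvol
    have h1 := aux_main hn hs0 hs1 hp0 hps ho hbd hC hsp hα hW hB ht0 htr hx₀ hball hU hvol
    rw [mul_div_cancel_right₀ _ hr.ne'] at h1
    have h2 : 8 * B * b ≤ ((2:ℝ) ^ (-α) / (2 * C)) ^ (1 / s) := by
      have : b ≤ b₀ := min_le_right _ _
      rw [hb₀, le_div_iff₀ (by positivity)] at this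
      linarith
    have h3 : (8 * B * b) ^ s ≤ (2:ℝ) ^ (-α) / (2 * C) := by
      calc _ ≤ (((2:ℝ) ^ (-α) / (2 * C)) ^ (1 / s)) ^ s := by gcongr
        _ = _ := by
          rw [← Real.rpow_mul (by positivity), one_div_mul_cancel hs0.ne', Real.rpow_one]
    rw [le_div_iff₀ (by positivity)] at h3
    linarith
  have hdisj : ∀ w, w ∈ connectedComponentIn (Ω \ ball z (b * r)) x →
      w ∉ connectedComponentIn (Ω \ ball z (b * r)) y := by
    intro w h1 h2
    apply hne
    rw [connectedComponentIn_eq h1, ← connectedComponentIn_eq h2]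
    exact mem_connectedComponentIn hy'
  rcases le_total (volume (connectedComponentIn (Ω \ ball z (b * r)) x))
    (volume (connectedComponentIn (Ω \ ball z (b * r)) y)) with hle | hle
  · exact contra x hx _ rfl (hle.trans (measure_mono fun w hw =>
      ⟨(connectedComponentIn_subset _ _ hw).1, fun h => hdisj w h hw⟩))
  · exact contra y hy _ rfl (hle.trans (measure_mono fun w hw =>
      ⟨(connectedComponentIn_subset _ _ hw).1, hdisj w hw⟩))
end
end

section
/- Let n ≥ 2. Every John domain Ω ⊆ ℝⁿ supports, for every s ∈ (0,1] and every p ∈ (n/(n+s), n/s), a (pn/(n−ps), p)_s-Hajłasz–Sobolev–Poincaré imbedding: there is a constant C > 0 such that ‖u − u_Ω‖_{L^{pn/(n−ps)}(Ω)} ≤ C ‖u‖_{Ṁ^{s,p}_ball(Ω)} for all u ∈ Ṁ^{s,p}_ball(Ω). -/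
open MeasureTheory Metric Set
open scoped ENNReal

noncomputable section

/-- averages over closed balls -/
def avgB {n : ℕ} (f : Eu n → ℝ≥0∞) (r : ℝ) (x : Eu n) : ℝ≥0∞ :=
  (volume (closedBall x r))⁻¹ * ∫⁻ z in closedBall x r, f z

lemma vol_cb {n : ℕ} (x : Eu n) {r : ℝ} (hr : 0 ≤ r) :
    volume (closedBall x r) = ENNReal.ofReal (r ^ n) * volume (ball (0 : Eu n) 1) := by
  have := Measure.addHaar_closedBall (volume : Measure (Eu n)) x hr
  simpa using this

lemma weak_type {n : ℕ} (h : Eu n → ℝ≥0∞) (r : ℕ → ℝ) (R : ℝ)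
    (hr : ∀ i, 0 < r i) (hR : ∀ i, r i ≤ R) (t : ℝ≥0∞) (ht : t ≠ 0) (ht' : t ≠ ⊤) :
    volume {x | ∃ i, t < avgB h (r i) x} ≤ ENNReal.ofReal (5 ^ n) * t⁻¹ * ∫⁻ z, h z := by
  set A : Set (Eu n) := {x | ∃ i, t < avgB h (r i) x} with hA
  have hex : ∀ x : Eu n, ∃ i, x ∈ A → t < avgB h (r i) x := by
    intro x
    by_cases hx : x ∈ A
    · obtain ⟨i, hi⟩ := hx
      exact ⟨i, fun _ => hi⟩
    · exact ⟨0, fun h => absurd h hx⟩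
  choose k hk using hex
  obtain ⟨U, hUA, hdisj, hcov⟩ := Vitali.exists_disjoint_subfamily_covering_enlargement_closedBall
    A (fun x => x) (fun x => r (k x)) R (fun a _ => hR _) 5 (by norm_num)
  have hUc : U.Countable := by
    apply hdisj.countable_of_nonempty_interior
    intro x _
    exact ⟨x, ball_subset_interior_closedBall (mem_ball_self (hr _))⟩
  have hAsub : A ⊆ ⋃ b ∈ U, closedBall b (5 * r (k b)) := by
    intro a ha
    obtain ⟨b, hb, hab⟩ := hcov a ha
    simp only [mem_iUnion]
    exact ⟨b, hb, hab (mem_closedBall_self (hr _).le)⟩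
  have hone : ∀ b ∈ U, volume (closedBall b (5 * r (k b))) ≤
      ENNReal.ofReal (5 ^ n) * t⁻¹ * ∫⁻ z in closedBall b (r (k b)), h z := by
    intro b hb
    have h1 := (hk b (hUA hb)).le
    have hr' := hr (k b)
    have hv : volume (closedBall b (5 * r (k b))) =
        ENNReal.ofReal (5 ^ n) * volume (closedBall b (r (k b))) := by
      rw [vol_cb b (by positivity), vol_cb b hr'.le, mul_pow, ENNReal.ofReal_mul (by positivity),
        mul_assoc]
    rw [hv, mul_assoc]
    gcongr
    unfold avgB at h1
    have hv0 : volume (closedBall b (r (k b))) ≠ 0 := (measure_closedBall_pos _ _ hr').ne'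
    have hvt : volume (closedBall b (r (k b))) ≠ ⊤ := measure_closedBall_lt_top.ne
    rw [mul_comm, ← div_eq_mul_inv, ENNReal.le_div_iff_mul_le (Or.inl hv0) (Or.inl hvt)] at h1
    rw [mul_comm t⁻¹, ← div_eq_mul_inv, ENNReal.le_div_iff_mul_le (Or.inl ht) (Or.inl ht'), mul_comm]
    exact h1
  have : Countable U := hUc.to_subtype
  calc volume A ≤ volume (⋃ b ∈ U, closedBall b (5 * r (k b))) := measure_mono hAsub
    _ ≤ ∑' b : U, volume (closedBall (b : Eu n) (5 * r (k b))) := measure_biUnion_le _ hUc _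
    _ ≤ ∑' b : U, ENNReal.ofReal (5 ^ n) * t⁻¹ * ∫⁻ z in closedBall (b : Eu n) (r (k b)), h z :=
        ENNReal.tsum_le_tsum fun b => hone b b.2
    _ = ENNReal.ofReal (5 ^ n) * t⁻¹ * ∫⁻ z in ⋃ b ∈ U, closedBall b (r (k b)), h z := by
        rw [ENNReal.tsum_mul_left, lintegral_biUnion hUc (fun _ _ => measurableSet_closedBall) hdisj]
    _ ≤ _ := by
        gcongr
        exact Measure.restrict_le_self

lemma avgB_meas {n : ℕ} {f : Eu n → ℝ≥0∞} (hf : Measurable f) (r : ℝ) (hr : 0 ≤ r) :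
    Measurable (avgB f r) := by
  have h1 : avgB f r = fun x => (ENNReal.ofReal (r ^ n) * volume (ball (0 : Eu n) 1))⁻¹ *
      ∫⁻ z, ({q : Eu n × Eu n | dist q.2 q.1 ≤ r}.indicator (fun q => f q.2)) (x, z) := by
    funext x
    unfold avgB
    rw [vol_cb x hr, ← lintegral_indicator measurableSet_closedBall]
    congr 1
  rw [h1]
  apply Measurable.const_mul
  apply Measurable.lintegral_prod_right'
  apply Measurable.indicator (hf.comp measurable_snd)
  exact measurableSet_le (by fun_prop) (by fun_prop)

lemma sq_le_layer (a : ℝ≥0∞) :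
    a ^ 2 ≤ 4 * ∫⁻ t in Ioi (0 : ℝ), ENNReal.ofReal t * (if ENNReal.ofReal t < a then 1 else 0) := by
  have key : ∀ b : ℝ, 0 < b → ENNReal.ofReal b ≤ a → ENNReal.ofReal b ^ 2 ≤
      4 * ∫⁻ t in Ioi (0 : ℝ), ENNReal.ofReal t * (if ENNReal.ofReal t < a then 1 else 0) := by
    intro b hb hba
    calc ENNReal.ofReal b ^ 2 = 4 * ∫⁻ t in Ioo (b/2) b, ENNReal.ofReal (b / 2) := by
          rw [lintegral_const, Measure.restrict_apply_univ, Real.volume_Ioo,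
            ← ENNReal.ofReal_mul (by positivity), ← ENNReal.ofReal_pow hb.le,
            show (4 : ℝ≥0∞) = ENNReal.ofReal 4 by simp, ← ENNReal.ofReal_mul (by positivity)]
          congr 1; ring
      _ ≤ 4 * ∫⁻ t in Ioo (b/2) b, ENNReal.ofReal t * (if ENNReal.ofReal t < a then 1 else 0) := by
          gcongr 4 * ?_
          apply setLIntegral_mono' measurableSet_Ioo
          intro t ht
          rw [if_pos (lt_of_lt_of_le ((ENNReal.ofReal_lt_ofReal_iff hb).2 ht.2) hba), mul_one]
          exact ENNReal.ofReal_le_ofReal ht.1.le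
      _ ≤ _ := by
          gcongr 4 * ?_
          apply lintegral_mono_set
          intro t ht
          exact lt_trans (by positivity : (0:ℝ) < b/2) ht.1
  rcases eq_or_ne a ⊤ with rfl | ha
  · refine le_trans le_top (le_of_eq ?_)
    symm
    refine ENNReal.eq_top_of_forall_nnreal_le ?_
    intro r
    refine le_trans ?_ (key (r + 1) (by positivity) le_top)
    rw [← ENNReal.ofReal_pow (by positivity), ← ENNReal.ofReal_coe_nnreal]
    apply ENNReal.ofReal_le_ofReal
    nlinarith [r.2, r.coe_nonneg]
  · rcases eq_or_ne a 0 with rfl | h0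
    · simp
    · have := key a.toReal (ENNReal.toReal_pos h0 ha) (ENNReal.ofReal_toReal ha).le
      rwa [ENNReal.ofReal_toReal ha] at this

lemma lin_layer (a : ℝ≥0∞) :
    ∫⁻ t in Ioi (0 : ℝ), (if ENNReal.ofReal t < 2 * a then (1 : ℝ≥0∞) else 0) ≤ 2 * a := by
  rcases eq_or_ne a ⊤ with rfl | ha
  · simp
  · have h2 : 2 * a ≠ ⊤ := ENNReal.mul_ne_top (by simp) ha
    have : ∀ t ∈ Ioi (0 : ℝ), (if ENNReal.ofReal t < 2 * a then (1 : ℝ≥0∞) else 0) ≤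
        (Ioo 0 (2 * a).toReal).indicator 1 t := by
      intro t ht
      split_ifs with h
      · rw [indicator_of_mem]
        · simp
        · exact ⟨ht, (ENNReal.ofReal_lt_iff_lt_toReal (le_of_lt ht) h2).1 h⟩
      · exact zero_le
    calc _ ≤ ∫⁻ t in Ioi (0 : ℝ), (Ioo 0 (2 * a).toReal).indicator 1 t :=
          setLIntegral_mono' measurableSet_Ioi this
      _ ≤ ∫⁻ t, (Ioo 0 (2 * a).toReal).indicator 1 t := by
          apply lintegral_mono' Measure.restrict_le_self le_rfl
      _ = 2 * a := by
          rw [lintegral_indicator_one measurableSet_Ioo, Real.volume_Ioo, sub_zero,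
            ENNReal.ofReal_toReal h2]

lemma maximal_L2 {n : ℕ} (f : Eu n → ℝ≥0∞) (hf : Measurable f) (r : ℕ → ℝ) (R : ℝ)
    (hr : ∀ i, 0 < r i) (hR : ∀ i, r i ≤ R) :
    ∫⁻ x, (⨆ i, avgB f (r i) x) ^ 2 ≤ 16 * ENNReal.ofReal (5 ^ n) * ∫⁻ x, f x ^ 2 := by
  set Mf : Eu n → ℝ≥0∞ := fun x => ⨆ i, avgB f (r i) x with hMf
  have hM : Measurable Mf := Measurable.iSup fun i => avgB_meas hf _ (hr i).le
  have hlev : ∀ t : ℝ, 0 < t → volume {x | ENNReal.ofReal t < Mf x} ≤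
      ENNReal.ofReal (5 ^ n) * (ENNReal.ofReal (t / 2))⁻¹ *
        ∫⁻ z, f z * (if ENNReal.ofReal t < 2 * f z then 1 else 0) := by
    intro t ht
    have ht2 : ENNReal.ofReal (t / 2) ≠ 0 := by simpa using ht
    refine le_trans (measure_mono ?_) (weak_type _ r R hr hR _ ht2 ENNReal.ofReal_ne_top)
    intro x hx
    obtain ⟨i, hi⟩ := lt_iSup_iff.1 (show ENNReal.ofReal t < ⨆ i, avgB f (r i) x from hx)
    refine ⟨i, ?_⟩
    by_contra hcon
    push Not at hcon
    have hv0 : volume (closedBall x (r i)) ≠ 0 := (measure_closedBall_pos _ _ (hr i)).ne'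
    have hvt : volume (closedBall x (r i)) ≠ ⊤ := measure_closedBall_lt_top.ne
    have : avgB f (r i) x ≤
        avgB (fun z => f z * (if ENNReal.ofReal t < 2 * f z then 1 else 0)) (r i) x
        + ENNReal.ofReal (t / 2) := by
      unfold avgB
      have : ENNReal.ofReal (t / 2) = (volume (closedBall x (r i)))⁻¹ *
          ∫⁻ z in closedBall x (r i), ENNReal.ofReal (t / 2) := by
        rw [lintegral_const, Measure.restrict_apply_univ, mul_comm, mul_assoc,
          ENNReal.mul_inv_cancel hv0 hvt, mul_one]
      conv_rhs => rw [this]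
      rw [← mul_add, ← lintegral_add_right _ measurable_const]
      gcongr with z
      split_ifs with h
      · simp
      · push Not at h
        simp only [mul_zero, zero_add]
        rw [ENNReal.ofReal_div_of_pos (by norm_num)]
        rw [ENNReal.le_div_iff_mul_le (by simp) (by simp)]
        simpa [mul_comm] using h
    have h2 : ENNReal.ofReal t ≠ ⊤ := ENNReal.ofReal_ne_top
    refine absurd (lt_of_lt_of_le hi (this.trans (add_le_add_left hcon _))) ?_
    rw [← ENNReal.ofReal_add (by positivity) (by positivity)]
    simp
  calc ∫⁻ x, Mf x ^ 2 ≤ ∫⁻ x, 4 * ∫⁻ t in Ioi (0 : ℝ),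
          ENNReal.ofReal t * (if ENNReal.ofReal t < Mf x then 1 else 0) :=
        lintegral_mono fun x => sq_le_layer _
    _ = 4 * ∫⁻ t in Ioi (0 : ℝ), ∫⁻ x,
          ENNReal.ofReal t * (if ENNReal.ofReal t < Mf x then 1 else 0) := by
        rw [lintegral_const_mul' _ _ (by simp), lintegral_lintegral_swap]
        apply Measurable.aemeasurable
        apply Measurable.mul (by fun_prop)
        apply Measurable.ite _ measurable_const measurable_const
        exact measurableSet_lt (by fun_prop) (by fun_prop)
    _ ≤ 4 * ∫⁻ t in Ioi (0 : ℝ), 2 * ENNReal.ofReal (5 ^ n) *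
          ∫⁻ z, f z * (if ENNReal.ofReal t < 2 * f z then 1 else 0) := by
        gcongr 4 * ?_
        apply setLIntegral_mono' measurableSet_Ioi
        intro t ht
        have ht : 0 < t := ht
        rw [lintegral_const_mul' _ _ ENNReal.ofReal_ne_top]
        have hms : MeasurableSet {x | ENNReal.ofReal t < Mf x} := measurableSet_lt measurable_const hM
        have e1 : ∫⁻ x, (if ENNReal.ofReal t < Mf x then (1 : ℝ≥0∞) else 0)
            = volume {x | ENNReal.ofReal t < Mf x} := by
          rw [← lintegral_indicator_one hms]
          congr 1
          funext x
          simp [indicator_apply]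
        rw [e1]
        refine (mul_le_mul_right (hlev t ht) _).trans (le_of_eq ?_)
        rw [← mul_assoc, ← mul_assoc]
        congr 1
        rw [mul_comm, ← mul_assoc, mul_comm]
        rw [mul_comm]
        rw [ENNReal.ofReal_div_of_pos (by norm_num), ENNReal.inv_div (by simp) (by simp)]
        rw [show ENNReal.ofReal 2 = 2 by simp]
        rw [ENNReal.div_mul_cancel (by simpa using ht) ENNReal.ofReal_ne_top]
    _ = 4 * (2 * ENNReal.ofReal (5 ^ n) * ∫⁻ z, f z * ∫⁻ t in Ioi (0 : ℝ),
           (if ENNReal.ofReal t < 2 * f z then 1 else 0)) := by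
        rw [lintegral_const_mul' _ _ (ENNReal.mul_ne_top (by simp) ENNReal.ofReal_ne_top),
          lintegral_lintegral_swap]
        · congr 3
          funext z
          rw [lintegral_const_mul]
          apply Measurable.ite _ measurable_const measurable_const
          exact measurableSet_lt (by fun_prop) (by fun_prop)
        · apply Measurable.aemeasurable
          apply Measurable.mul (by fun_prop)
          apply Measurable.ite _ measurable_const measurable_const
          exact measurableSet_lt (by fun_prop) (by fun_prop)
    _ ≤ 4 * (2 * ENNReal.ofReal (5 ^ n) * ∫⁻ z, 2 * f z ^ 2) := by
        gcongr 4 * (2 * ENNReal.ofReal (5 ^ n) * ?_)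
        refine lintegral_mono fun z => ?_
        refine (mul_le_mul_right (lin_layer (f z)) _).trans (le_of_eq ?_)
        ring
    _ = _ := by
        rw [lintegral_const_mul _ (hf.pow_const 2)]
        ring

lemma two_sided_sum (b : ℝ) (hb0 : 0 < b) (hb1 : b < 1) :
    ∃ K : ℝ, 0 < K ∧ ∀ t : ℝ, ∑' i : ℕ, ENNReal.ofReal (b ^ |(i : ℝ) - t|) ≤ ENNReal.ofReal K := by
  have hsum : Summable (fun j : ℤ => b⁻¹ * b ^ j.natAbs) := by
    apply Summable.mul_left
    apply Summable.of_nat_of_neg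
    · simpa using summable_geometric_of_lt_one hb0.le hb1
    · simpa using summable_geometric_of_lt_one hb0.le hb1
  refine ⟨(∑' j : ℤ, b⁻¹ * b ^ j.natAbs) + 1, ?_, ?_⟩
  · have : 0 ≤ ∑' j : ℤ, b⁻¹ * b ^ j.natAbs := tsum_nonneg fun j => by positivity
    linarith
  intro t
  have h1 : ∀ i : ℕ, ENNReal.ofReal (b ^ |(i : ℝ) - t|) ≤
      ENNReal.ofReal (b⁻¹ * b ^ ((i : ℤ) - ⌊t⌋).natAbs) := by
    intro i
    apply ENNReal.ofReal_le_ofReal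
    rw [← Real.rpow_natCast, ← Real.rpow_neg_one b, ← Real.rpow_add hb0]
    apply Real.rpow_le_rpow_of_exponent_ge hb0 hb1.le
    have e : (((i : ℤ) - ⌊t⌋).natAbs : ℝ) = |(i : ℝ) - ⌊t⌋| := by
      rw [Nat.cast_natAbs]; push_cast; rfl
    rw [e]
    have h2 : |(i : ℝ) - ⌊t⌋| ≤ |(i : ℝ) - t| + |t - ⌊t⌋| := abs_sub_le _ _ _
    have h3 : |t - ⌊t⌋| ≤ 1 := by
      rw [abs_le]; constructor <;> linarith [Int.floor_le t, Int.lt_floor_add_one t]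
    linarith
  calc ∑' i : ℕ, ENNReal.ofReal (b ^ |(i : ℝ) - t|)
      ≤ ∑' i : ℕ, ENNReal.ofReal (b⁻¹ * b ^ ((i : ℤ) - ⌊t⌋).natAbs) := ENNReal.tsum_le_tsum h1
    _ ≤ ∑' j : ℤ, ENNReal.ofReal (b⁻¹ * b ^ j.natAbs) :=
        ENNReal.tsum_comp_le_tsum_of_injective (f := fun i : ℕ => (i : ℤ) - ⌊t⌋)
          (fun i j h => by simpa using h) (fun j : ℤ => ENNReal.ofReal (b⁻¹ * b ^ j.natAbs))
    _ = ENNReal.ofReal (∑' j : ℤ, b⁻¹ * b ^ j.natAbs) :=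
        (ENNReal.ofReal_tsum_of_nonneg (fun j => by positivity) hsum).symm
    _ ≤ _ := ENNReal.ofReal_le_ofReal (by linarith)

lemma series_bound (W l α β : ℝ) (hW : 0 < W) (hl0 : 0 < l) (hl1 : l < 1) (hα : 0 < α)
    (hβ : 0 < β) : ∃ K : ℝ, 0 < K ∧ ∀ (P Q : ℝ≥0∞) (a : ℕ → ℝ≥0∞),
      (∀ i, a i ≤ ENNReal.ofReal ((W * l ^ i) ^ α) * P) →
      (∀ i, a i ≤ ENNReal.ofReal ((W * l ^ i) ^ (-β)) * Q) →
      ∑' i, a i ≤ ENNReal.ofReal K * (Q ^ (α / (α + β)) * P ^ (β / (α + β))) := by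
  set δ := min α β with hδ
  have hδ0 : 0 < δ := lt_min hα hβ
  obtain ⟨K, hK, hKb⟩ := two_sided_sum (l ^ δ) (by positivity) (Real.rpow_lt_one hl0.le hl1 hδ0)
  refine ⟨K, hK, fun P Q a hP hQ => ?_⟩
  have hab : 0 < α + β := by positivity
  have ha' : 0 < α / (α + β) := by positivity
  have hb' : 0 < β / (α + β) := by positivity
  have hK0 : ENNReal.ofReal K ≠ 0 := by simpa using hK
  by_cases hP0 : P = 0
  · have : ∀ i, a i = 0 := fun i => by simpa [hP0] using hP i
    simp [this]
  by_cases hQ0 : Q = 0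
  · have : ∀ i, a i = 0 := fun i => by simpa [hQ0] using hQ i
    simp [this]
  by_cases hPt : P = ⊤
  · have : ENNReal.ofReal K * (Q ^ (α / (α + β)) * P ^ (β / (α + β))) = ⊤ := by
      rw [hPt, ENNReal.top_rpow_of_pos hb', ENNReal.mul_top, ENNReal.mul_top hK0]
      simp [ENNReal.rpow_eq_zero_iff, hQ0, ha'.le]
    rw [this]; exact le_top
  by_cases hQt : Q = ⊤
  · have : ENNReal.ofReal K * (Q ^ (α / (α + β)) * P ^ (β / (α + β))) = ⊤ := by
      rw [hQt, ENNReal.top_rpow_of_pos ha', ENNReal.top_mul, ENNReal.mul_top hK0]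
      simp [ENNReal.rpow_eq_zero_iff, hP0, hb'.le]
    rw [this]; exact le_top
  obtain ⟨p, hp, rfl⟩ : ∃ p : ℝ, 0 < p ∧ P = ENNReal.ofReal p :=
    ⟨P.toReal, ENNReal.toReal_pos hP0 hPt, (ENNReal.ofReal_toReal hPt).symm⟩
  obtain ⟨q, hq, rfl⟩ : ∃ q : ℝ, 0 < q ∧ Q = ENNReal.ofReal q :=
    ⟨Q.toReal, ENNReal.toReal_pos hQ0 hQt, (ENNReal.ofReal_toReal hQt).symm⟩
  rw [ENNReal.ofReal_rpow_of_pos hp, ENNReal.ofReal_rpow_of_pos hq,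
    ← ENNReal.ofReal_mul (by positivity)]
  set T := q ^ (α / (α + β)) * p ^ (β / (α + β)) with hT
  have hT0 : 0 < T := by positivity
  set ws := (q / p) ^ (1 / (α + β)) with hws
  have hws0 : 0 < ws := by positivity
  have hlogl : Real.log l < 0 := Real.log_neg hl0 hl1
  set t := Real.log (ws / W) / Real.log l with ht
  have hlt : l ^ t = ws / W := by
    rw [Real.rpow_def_of_pos hl0, ht, mul_div_cancel₀ _ hlogl.ne, Real.exp_log (by positivity)]
  have hw : ∀ i : ℕ, W * l ^ i = ws * l ^ ((i : ℝ) - t) := by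
    intro i
    rw [Real.rpow_sub hl0, hlt, Real.rpow_natCast]
    field_simp
  have hT1 : ws ^ α * p = T := by
    rw [hws, hT, ← Real.rpow_mul (by positivity), Real.div_rpow hq.le hp.le,
      show 1 / (α + β) * α = α / (α + β) by ring]
    have : p = p ^ (α / (α + β)) * p ^ (β / (α + β)) := by
      rw [← Real.rpow_add hp, show α / (α + β) + β / (α + β) = 1 by field_simp, Real.rpow_one]
    rw [div_mul_eq_mul_div, div_eq_iff (by positivity)]
    calc q ^ (α / (α + β)) * p = q ^ (α / (α + β)) * (p ^ (α / (α + β)) * p ^ (β / (α + β))) :=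
          congrArg _ this
      _ = _ := by ring
  have hT2 : ws ^ (-β) * q = T := by
    have h1 : ws ^ (α + β) = q / p := by
      rw [hws, ← Real.rpow_mul (by positivity), show 1 / (α + β) * (α + β) = 1 by field_simp,
        Real.rpow_one]
    have h2 : q = ws ^ (α + β) * p := by rw [h1]; field_simp
    conv_lhs => rw [h2]
    rw [← mul_assoc, ← Real.rpow_add hws0, show -β + (α + β) = α by ring, hT1]
  have key : ∀ i : ℕ, a i ≤ ENNReal.ofReal ((l ^ δ) ^ |(i : ℝ) - t|) * ENNReal.ofReal T := by
    intro i
    rw [← Real.rpow_mul hl0.le, ← ENNReal.ofReal_mul (by positivity)]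
    rcases le_total t i with h | h
    · refine (hP i).trans ?_
      rw [← ENNReal.ofReal_mul (by positivity)]
      apply ENNReal.ofReal_le_ofReal
      rw [hw, Real.mul_rpow hws0.le (by positivity), ← hT1, abs_of_nonneg (by linarith),
        ← Real.rpow_mul hl0.le]
      have : l ^ (((i : ℝ) - t) * α) ≤ l ^ (δ * ((i : ℝ) - t)) := by
        apply Real.rpow_le_rpow_of_exponent_ge hl0 hl1.le
        rw [mul_comm]
        exact mul_le_mul_of_nonneg_left (min_le_left _ _) (by linarith)
      calc ws ^ α * l ^ (((i : ℝ) - t) * α) * p = l ^ (((i : ℝ) - t) * α) * (ws ^ α * p) := by ring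
        _ ≤ _ := by gcongr
    · refine (hQ i).trans ?_
      rw [← ENNReal.ofReal_mul (by positivity)]
      apply ENNReal.ofReal_le_ofReal
      rw [hw, Real.mul_rpow hws0.le (by positivity), ← hT2, abs_of_nonpos (by linarith),
        ← Real.rpow_mul hl0.le]
      have : l ^ (((i : ℝ) - t) * (-β)) ≤ l ^ (δ * (-((i : ℝ) - t))) := by
        apply Real.rpow_le_rpow_of_exponent_ge hl0 hl1.le
        have : δ * (t - i) ≤ β * (t - i) :=
          mul_le_mul_of_nonneg_right (min_le_right _ _) (by linarith)
        nlinarith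
      calc ws ^ (-β) * l ^ (((i : ℝ) - t) * (-β)) * q
          = l ^ (((i : ℝ) - t) * (-β)) * (ws ^ (-β) * q) := by ring
        _ ≤ _ := by gcongr
  calc ∑' i, a i ≤ ∑' i : ℕ, ENNReal.ofReal ((l ^ δ) ^ |(i : ℝ) - t|) * ENNReal.ofReal T :=
        ENNReal.tsum_le_tsum key
    _ = (∑' i : ℕ, ENNReal.ofReal ((l ^ δ) ^ |(i : ℝ) - t|)) * ENNReal.ofReal T :=
        ENNReal.tsum_mul_right
    _ ≤ _ := by gcongr; exact hKb t

lemma john_curve {n : ℕ} {Ω : Set (Eu n)} (hΩ : IsOpen Ω) (hne : Ωᶜ.Nonempty)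
    (hJ : IsJohnDomain Ω) : ∃ x₀ ∈ Ω, ∃ c W : ℝ, 0 < c ∧ c < 1 ∧ 0 < W ∧
      ∀ x ∈ Ω, ∀ ρ : ℝ, 0 < ρ → ρ ≤ infDist x Ωᶜ → ρ ≤ W ∧ ∃ ζ : ℝ → Eu n,
        ζ ρ = x ∧ ζ W = x₀ ∧
        (∀ a ∈ Icc ρ W, ∀ b ∈ Icc ρ W, dist (ζ a) (ζ b) ≤ |a - b|) ∧
        ∀ a ∈ Icc ρ W, c * a ≤ infDist (ζ a) Ωᶜ := by
  obtain ⟨x₀, hx₀, C, hC, hcurve⟩ := hJ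
  have hd0 : 0 < infDist x₀ Ωᶜ := by
    rw [← hΩ.isClosed_compl.notMem_iff_infDist_pos hne]; simpa using hx₀
  set c := C / (C + 2) with hc
  have hc0 : 0 < c := by positivity
  have hc1 : c < 1 := by rw [hc, div_lt_one (by positivity)]; linarith
  refine ⟨x₀, hx₀, c, infDist x₀ Ωᶜ / c, hc0, hc1, by positivity, ?_⟩
  intro x hx ρ hρ hρd
  obtain ⟨ℓ, hℓ, γ, hlip, hγ0, hγℓ, hγ⟩ := hcurve x hx
  have hdist : ∀ t ∈ Icc (0 : ℝ) ℓ, ∀ t' ∈ Icc (0 : ℝ) ℓ, dist (γ t) (γ t') ≤ |t - t'| := by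
    intro t ht t' ht'
    have := hlip.dist_le_mul t ht t' ht'
    simpa [Real.dist_eq] using this
  have hlow : ∀ t ∈ Icc (0 : ℝ) ℓ, c * (ρ + t) ≤ infDist (γ t) Ωᶜ := by
    intro t ht
    have h1 := (hγ t ht).2
    have h2 : infDist x Ωᶜ ≤ infDist (γ t) Ωᶜ + dist x (γ t) := infDist_le_infDist_add_dist
    have h3 : dist x (γ t) ≤ t := by
      have := hdist 0 ⟨le_rfl, hℓ⟩ t ht
      rw [hγ0] at this
      simpa [abs_of_nonneg ht.1] using this
    rw [hc, div_mul_eq_mul_div, div_le_iff₀ (by positivity)]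
    nlinarith
  have hW : ρ + ℓ ≤ infDist x₀ Ωᶜ / c := by
    rw [le_div_iff₀ hc0]
    have := hlow ℓ ⟨hℓ, le_rfl⟩
    rw [hγℓ] at this
    linarith
  refine ⟨by linarith, fun w => γ (min (w - ρ) ℓ), ?_, ?_, ?_, ?_⟩
  · simp [hℓ, hγ0]
  · have : min (infDist x₀ Ωᶜ / c - ρ) ℓ = ℓ := min_eq_right (by linarith)
    simp only [this, hγℓ]
  · intro a ha b hb
    refine (hdist _ ⟨le_min (by linarith [ha.1]) hℓ, min_le_right _ _⟩ _
      ⟨le_min (by linarith [hb.1]) hℓ, min_le_right _ _⟩).trans ?_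
    refine (abs_min_sub_min_le_max _ _ _ _).trans ?_
    simp
  · intro a ha
    rcases le_total (a - ρ) ℓ with h | h
    · simp only [min_eq_left h]
      have := hlow (a - ρ) ⟨by linarith [ha.1], h⟩
      simpa using this
    · simp only [min_eq_right h, hγℓ]
      have := ha.2
      rw [le_div_iff₀ hc0] at this
      linarith

lemma chain_bound {n : ℕ} {Ω : Set (Eu n)} (hΩ : IsOpen Ω) (hne : Ωᶜ.Nonempty)
    {x₀ : Eu n} {c W : ℝ} (hc0 : 0 < c) (hc1 : c < 1) (hW : 0 < W)
    (hJ : ∀ x ∈ Ω, ∀ ρ : ℝ, 0 < ρ → ρ ≤ infDist x Ωᶜ → ρ ≤ W ∧ ∃ ζ : ℝ → Eu n,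
        ζ ρ = x ∧ ζ W = x₀ ∧
        (∀ a ∈ Icc ρ W, ∀ b ∈ Icc ρ W, dist (ζ a) (ζ b) ≤ |a - b|) ∧
        ∀ a ∈ Icc ρ W, c * a ≤ infDist (ζ a) Ωᶜ)
    {s p : ℝ} (hs : s ∈ Ioc (0 : ℝ) 1) (hp : 0 < p) (u g : Eu n → ℝ)
    (hg : g ∈ DBall Ω s (1 / 2) u) :
    ∃ c₀ : ℝ, ∀ᵐ x ∂(volume.restrict Ω), ENNReal.ofReal |u x - c₀| ≤
      ∑' i : ℕ, ENNReal.ofReal (4 * (W * (1 - c / 10) ^ i) ^ s) *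
        (ENNReal.ofReal ((20 / c) ^ n) *
        avgB (Ω.indicator fun z => ENNReal.ofReal (g z) ^ (p / 2))
          (2 * (W * (1 - c / 10) ^ i)) x) ^ (2 / p) := by
  obtain ⟨hgm, hg0, N, hNΩ, hN, hgrad⟩ := hg
  set f : Eu n → ℝ≥0∞ := Ω.indicator fun z => ENNReal.ofReal (g z) ^ (p / 2) with hf
  have hfm : Measurable f := by
    apply Measurable.indicator _ hΩ.measurableSet
    exact (ENNReal.measurable_ofReal.comp hgm).pow_const _
  set κ := c / 10 with hκ
  have hκ0 : 0 < κ := by positivity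
  have hκ1 : κ < 1 / 10 := by rw [hκ]; linarith
  have hcκ : c = 10 * κ := by rw [hκ]; ring
  -- gradient condition in real terms
  have hgr : ∀ x ∈ Ω \ N, ∀ y ∈ Ω \ N, ∀ d r : ℝ, dist x y ≤ r → r < d / 2 → d ≤ infDist x Ωᶜ →
      |u x - u y| ≤ r ^ s * (g x + g y) := by
    intro x hx y hy d r hr hrd hd
    refine (hgrad x hx y hy ?_).trans ?_
    · rw [edist_dist]
      calc ENNReal.ofReal (dist x y) < ENNReal.ofReal (1 / 2 * infDist x Ωᶜ) := by
            rw [ENNReal.ofReal_lt_ofReal_iff_of_nonneg dist_nonneg]; linarith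
        _ = ENNReal.ofReal (1 / 2) * ENNReal.ofReal (infDist x Ωᶜ) :=
            ENNReal.ofReal_mul (by norm_num)
        _ ≤ _ := by
            gcongr
            exact ENNReal.ofReal_toReal_le
    · have := hg0 x
      have := hg0 y
      have := hs.1.le
      gcongr
  have hball : ∀ z : Eu n, ∀ w : ℝ, 0 < w → c * w ≤ infDist z Ωᶜ → closedBall z (κ * w) ⊆ Ω := by
    intro z w hw hz y hy
    by_contra hyn
    have h1 : infDist z Ωᶜ ≤ dist z y := infDist_le_dist_of_mem hyn
    rw [mem_closedBall, dist_comm] at hy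
    nlinarith [mul_pos hκ0 hw]
  -- selection
  have hsel : ∀ z : Eu n, ∀ w : ℝ, ∃ y : Eu n, 0 < w → c * w ≤ infDist z Ωᶜ →
      y ∈ closedBall z (κ * w) ∧ y ∈ Ω \ N ∧
      ∀ x, dist x z ≤ w → ENNReal.ofReal (g y) ≤
        (ENNReal.ofReal ((20 / c) ^ n) * avgB f (2 * w) x) ^ (2 / p) := by
    intro z w
    by_cases hw : 0 < w ∧ c * w ≤ infDist z Ωᶜ
    swap
    · exact ⟨z, fun h1 h2 => absurd ⟨h1, h2⟩ hw⟩
    obtain ⟨hw, hz⟩ := hw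
    have hsub := hball z w hw hz
    have hκw : 0 < κ * w := by positivity
    have hv0 : volume (closedBall z (κ * w)) ≠ 0 := (measure_closedBall_pos _ _ hκw).ne'
    have hvt : volume (closedBall z (κ * w)) ≠ ⊤ := measure_closedBall_lt_top.ne
    have : IsFiniteMeasure (volume.restrict (closedBall z (κ * w))) :=
      isFiniteMeasure_restrict.2 hvt
    obtain ⟨y, hyN, hy⟩ := exists_notMem_null_le_laverage
      (μ := volume.restrict (closedBall z (κ * w))) (f := f)
      (N := N ∪ (closedBall z (κ * w))ᶜ)
      (by simpa [Measure.restrict_eq_zero] using hv0) hfm.aemeasurable (by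
        refine measure_union_null ?_ ?_
        · exact le_antisymm ((Measure.restrict_apply_le _ _).trans hN.le) zero_le
        · rw [Measure.restrict_apply measurableSet_closedBall.compl]; simp)
    have hyB : y ∈ closedBall z (κ * w) := by
      by_contra h; exact hyN (Or.inr h)
    have hyΩ : y ∈ Ω := hsub hyB
    refine ⟨y, fun _ _ => ⟨hyB, ⟨hyΩ, fun h => hyN (Or.inl h)⟩, ?_⟩⟩
    intro x hx
    have h1 : ENNReal.ofReal (g y) ^ (p / 2) ≤ ENNReal.ofReal ((20 / c) ^ n) * avgB f (2 * w) x := by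
      have e : f y = ENNReal.ofReal (g y) ^ (p / 2) := indicator_of_mem hyΩ _
      rw [← e]
      refine hy.trans ?_
      rw [setLAverage_eq]
      have hsubx : closedBall z (κ * w) ⊆ closedBall x (2 * w) := by
        apply closedBall_subset_closedBall'
        rw [dist_comm]
        nlinarith
      have hvol : volume (closedBall x (2 * w)) =
          ENNReal.ofReal ((20 / c) ^ n) * volume (closedBall z (κ * w)) := by
        rw [vol_cb _ (by positivity), vol_cb _ hκw.le, ← mul_assoc,
          ← ENNReal.ofReal_mul (by positivity), ← mul_pow]
        congr 3
        rw [hκ]; field_simp; ring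
      unfold avgB
      rw [hvol, ENNReal.mul_inv (Or.inr hvt) (Or.inr hv0), ← mul_assoc, ← mul_assoc,
        ENNReal.mul_inv_cancel (by simp; positivity) ENNReal.ofReal_ne_top, one_mul,
        ENNReal.div_eq_inv_mul]
      gcongr
    calc ENNReal.ofReal (g y) = (ENNReal.ofReal (g y) ^ (p / 2)) ^ (2 / p) := by
          rw [← ENNReal.rpow_mul, show p / 2 * (2 / p) = 1 by field_simp, ENNReal.rpow_one]
      _ ≤ _ := ENNReal.rpow_le_rpow h1 (by positivity)
  choose Y hY using hsel
  set l := 1 - κ with hl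
  have hl0 : 9 / 10 < l := by rw [hl]; linarith
  have hl1 : l < 1 := by rw [hl]; linarith
  set w : ℕ → ℝ := fun i => W * l ^ i with hw
  have hwpos : ∀ i, 0 < w i := fun i => by simp only [hw]; positivity
  have hwsucc : ∀ i, w (i + 1) = l * w i := fun i => by simp only [hw]; ring
  have hwanti : Antitone w := antitone_nat_of_succ_le fun i => by
    rw [hwsucc]; nlinarith [hwpos i]
  have hw0 : w 0 = W := by simp [hw]
  have hwlim : Filter.Tendsto w Filter.atTop (nhds 0) := by
    have := (tendsto_pow_atTop_nhds_zero_of_lt_one (by linarith : (0:ℝ) ≤ l) hl1).const_mul W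
    simpa using this
  refine ⟨u (Y x₀ W), ?_⟩
  have hNae : ∀ᵐ x ∂(volume.restrict Ω), x ∉ N := by
    rw [ae_iff]; simp only [not_not]
    exact le_antisymm ((Measure.restrict_apply_le _ _).trans hN.le) zero_le
  filter_upwards [hNae, ae_restrict_mem hΩ.measurableSet] with x hxN hxΩ
  have hdx : 0 < infDist x Ωᶜ := by
    rw [← hΩ.isClosed_compl.notMem_iff_infDist_pos hne]; simpa using hxΩ
  set b : ℕ → ℝ≥0∞ := fun i => (ENNReal.ofReal ((20 / c) ^ n) * avgB f (2 * w i) x) ^ (2 / p)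
    with hb
  have main : ∀ m, w m ≤ infDist x Ωᶜ → ENNReal.ofReal |u x - u (Y x₀ W)| ≤
      ENNReal.ofReal (w m ^ s * g x) + ∑' i, ENNReal.ofReal (4 * w i ^ s) * b i := by
    intro m hm
    obtain ⟨-, ζ, hζ1, hζ2, hζ3, hζ4⟩ := hJ x hxΩ (w m) (hwpos m) hm
    set y : ℕ → Eu n := fun i => Y (ζ (w i)) (w i) with hy
    have hmem : ∀ i ≤ m, w i ∈ Icc (w m) W := fun i hi => ⟨hwanti hi, hw0 ▸ hwanti (Nat.zero_le i)⟩
    have hyY : ∀ i ≤ m, y i ∈ closedBall (ζ (w i)) (κ * w i) ∧ y i ∈ Ω \ N ∧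
        ∀ x, dist x (ζ (w i)) ≤ w i → ENNReal.ofReal (g (y i)) ≤
        (ENNReal.ofReal ((20 / c) ^ n) * avgB f (2 * w i) x) ^ (2 / p) := fun i hi =>
      hY (ζ (w i)) (w i) (hwpos i) (hζ4 _ (hmem i hi))
    have hyd : ∀ i ≤ m, 9 * κ * w i ≤ infDist (y i) Ωᶜ := by
      intro i hi
      have h1 := hζ4 _ (hmem i hi)
      have h2 : infDist (ζ (w i)) Ωᶜ ≤ infDist (y i) Ωᶜ + dist (ζ (w i)) (y i) :=
        infDist_le_infDist_add_dist
      have h3 := (hyY i hi).1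
      rw [mem_closedBall, dist_comm] at h3
      rw [hcκ] at h1
      linarith
    have hgy : ∀ i ≤ m, ENNReal.ofReal (g (y i)) ≤ b i := by
      intro i hi
      apply (hyY i hi).2.2
      have := hζ3 _ (hmem m le_rfl) _ (hmem i hi)
      rw [hζ1, abs_sub_comm, abs_of_nonneg (by linarith [hwanti hi])] at this
      linarith [hwpos m]
    have hstep : ∀ i, i + 1 ≤ m → |u (y i) - u (y (i + 1))| ≤
        w i ^ s * g (y i) + 2 * (w (i + 1) ^ s * g (y (i + 1))) := by
      intro i hi
      have hwi := hwpos i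
      have hd : dist (y i) (y (i + 1)) ≤ 3 * κ * w i := by
        have h1 := (hyY i (by omega)).1
        have h2 := (hyY (i + 1) hi).1
        rw [mem_closedBall] at h1 h2
        rw [dist_comm] at h2
        have h3 := hζ3 _ (hmem i (by omega)) _ (hmem (i + 1) hi)
        rw [hwsucc, abs_of_nonneg (by nlinarith), ← hwsucc] at h3
        have h4 : w (i + 1) ≤ w i := hwanti (Nat.le_succ i)
        have h5 : w i - w (i + 1) = κ * w i := by rw [hwsucc, hl]; ring
        have h6 := dist_triangle4 (y i) (ζ (w i)) (ζ (w (i + 1))) (y (i + 1))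
        have h7 : κ * w (i + 1) ≤ κ * w i := by gcongr
        linarith
      have h1 := hgr _ (hyY i (by omega)).2.1 _ (hyY (i + 1) hi).2.1 (9 * κ * w i) (3 * κ * w i) hd
        (by nlinarith [mul_pos hκ0 hwi]) (hyd i (by omega))
      have h2 : (3 * κ * w i) ^ s ≤ w i ^ s := by
        apply Real.rpow_le_rpow (by positivity) _ hs.1.le
        nlinarith
      have h3 : w i ^ s ≤ 2 * w (i + 1) ^ s := by
        have : w i ≤ 2 * w (i + 1) := by rw [hwsucc]; nlinarith
        calc w i ^ s ≤ (2 * w (i + 1)) ^ s := Real.rpow_le_rpow hwi.le this hs.1.le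
          _ = 2 ^ s * w (i + 1) ^ s := Real.mul_rpow (by norm_num) (hwpos _).le
          _ ≤ 2 * w (i + 1) ^ s := by
              have : (2 : ℝ) ^ s ≤ 2 ^ (1 : ℝ) :=
                Real.rpow_le_rpow_of_exponent_le (by norm_num) hs.2
              rw [Real.rpow_one] at this
              have h0 := Real.rpow_nonneg (hwpos (i + 1)).le s
              gcongr
      have g1 := hg0 (y i)
      have g2 := hg0 (y (i + 1))
      calc _ ≤ _ := h1
        _ ≤ w i ^ s * (g (y i) + g (y (i + 1))) := by gcongr
        _ = w i ^ s * g (y i) + w i ^ s * g (y (i + 1)) := by ring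
        _ ≤ w i ^ s * g (y i) + (2 * w (i + 1) ^ s) * g (y (i + 1)) := by gcongr
        _ = _ := by ring
    have hind : ∀ k ≤ m, |u (y k) - u (y 0)| ≤
        ∑ i ∈ Finset.range k, 3 * (w i ^ s * g (y i)) + 2 * (w k ^ s * g (y k)) := by
      intro k
      induction k with
      | zero =>
        intro _
        have := mul_nonneg (Real.rpow_nonneg (hwpos 0).le s) (hg0 (y 0))
        simp only [sub_self, abs_zero, Finset.range_zero, Finset.sum_empty]
        linarith
      | succ k ih =>
        intro hk
        have h1 := ih (by omega)
        have h2 := hstep k hk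
        rw [Finset.sum_range_succ]
        have h3 := abs_sub_le (u (y (k + 1))) (u (y k)) (u (y 0))
        rw [abs_sub_comm (u (y (k + 1))) (u (y k))] at h3
        linarith
    have hlast : |u x - u (y m)| ≤ w m ^ s * g x + w m ^ s * g (y m) := by
      have h0 := (hyY m le_rfl).1
      rw [hζ1, mem_closedBall, dist_comm] at h0
      have hwm := hwpos m
      have h1 := hgr x ⟨hxΩ, hxN⟩ (y m) (hyY m le_rfl).2.1 (w m) (κ * w m) h0 (by nlinarith) hm
      have h2 : (κ * w m) ^ s ≤ w m ^ s := by
        apply Real.rpow_le_rpow (by positivity) _ hs.1.le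
        nlinarith
      have g1 := hg0 x
      have g2 := hg0 (y m)
      calc _ ≤ _ := h1
        _ ≤ w m ^ s * (g x + g (y m)) := by gcongr
        _ = _ := by ring
    have hy0 : y 0 = Y x₀ W := by simp only [hy, hw0, hζ2]
    have htot : |u x - u (Y x₀ W)| ≤ w m ^ s * g x +
        ∑ i ∈ Finset.range (m + 1), 4 * w i ^ s * g (y i) := by
      have h1 := hind m le_rfl
      have h3 := abs_sub_le (u x) (u (y m)) (u (y 0))
      rw [hy0] at h3 h1
      have h4 : ∑ i ∈ Finset.range m, 3 * (w i ^ s * g (y i)) ≤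
          ∑ i ∈ Finset.range m, 4 * w i ^ s * g (y i) := by
        apply Finset.sum_le_sum
        intro i _
        have := mul_nonneg (Real.rpow_nonneg (hwpos i).le s) (hg0 (y i))
        linarith
      have := mul_nonneg (Real.rpow_nonneg (hwpos m).le s) (hg0 (y m))
      rw [Finset.sum_range_succ]
      linarith
    have hnn : ∀ i, 0 ≤ 4 * w i ^ s := fun i => by
      have := Real.rpow_nonneg (hwpos i).le s
      positivity
    calc ENNReal.ofReal |u x - u (Y x₀ W)| ≤ ENNReal.ofReal (w m ^ s * g x +
        ∑ i ∈ Finset.range (m + 1), 4 * w i ^ s * g (y i)) := ENNReal.ofReal_le_ofReal htot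
      _ = ENNReal.ofReal (w m ^ s * g x) +
          ∑ i ∈ Finset.range (m + 1), ENNReal.ofReal (4 * w i ^ s) * ENNReal.ofReal (g (y i)) := by
          rw [ENNReal.ofReal_add, ENNReal.ofReal_sum_of_nonneg]
          · congr 1
            exact Finset.sum_congr rfl fun i _ => ENNReal.ofReal_mul (hnn i)
          · intro i _
            exact mul_nonneg (hnn i) (hg0 _)
          · exact mul_nonneg (Real.rpow_nonneg (hwpos m).le s) (hg0 x)
          · exact Finset.sum_nonneg fun i _ => mul_nonneg (hnn i) (hg0 _)
      _ ≤ ENNReal.ofReal (w m ^ s * g x) +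
          ∑ i ∈ Finset.range (m + 1), ENNReal.ofReal (4 * w i ^ s) * b i := by
          gcongr with i hi
          exact hgy i (by simpa [Nat.lt_succ_iff] using hi)
      _ ≤ _ := by
          gcongr
          exact ENNReal.sum_le_tsum _
  have hlim : Filter.Tendsto (fun m => ENNReal.ofReal (w m ^ s * g x) +
      ∑' i, ENNReal.ofReal (4 * w i ^ s) * b i) Filter.atTop
      (nhds (0 + ∑' i, ENNReal.ofReal (4 * w i ^ s) * b i)) := by
    apply Filter.Tendsto.add _ tendsto_const_nhds
    have h1 : Filter.Tendsto (fun m => w m ^ s * g x) Filter.atTop (nhds (0 ^ s * g x)) :=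
      (hwlim.rpow_const (Or.inr hs.1.le)).mul_const _
    rw [Real.zero_rpow hs.1.ne', zero_mul] at h1
    have h2 := (ENNReal.continuous_ofReal.tendsto 0).comp h1
    rw [ENNReal.ofReal_zero] at h2
    exact h2
  rw [zero_add] at hlim
  refine ge_of_tendsto hlim ?_
  have hev : ∀ᶠ m in Filter.atTop, w m < infDist x Ωᶜ := hwlim.eventually_lt_const hdx
  filter_upwards [hev] with m hm
  exact main m hm.le

lemma avgB_holder {n : ℕ} {f : Eu n → ℝ≥0∞} (hf : Measurable f) {p w : ℝ} (hp : 0 < p)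
    (hw : 0 < w) (x : Eu n) :
    (avgB f (2 * w) x) ^ (2 / p) ≤ ENNReal.ofReal (w ^ (-(n / p) : ℝ)) *
      ((volume (ball (0 : Eu n) 1))⁻¹ * ∫⁻ z, f z ^ 2) ^ (1 / p) := by
  set V := volume (closedBall x (2 * w)) with hV
  have hv0 : V ≠ 0 := (measure_closedBall_pos _ _ (by positivity)).ne'
  have hvt : V ≠ ⊤ := measure_closedBall_lt_top.ne
  have h1 : (avgB f (2 * w) x) ^ 2 ≤ V⁻¹ * ∫⁻ z, f z ^ 2 := by
    have h2 := ENNReal.lintegral_mul_le_Lp_mul_Lq (volume.restrict (closedBall x (2 * w)))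
      Real.HolderConjugate.two_two hf.aemeasurable (aemeasurable_const (b := (1 : ℝ≥0∞)))
    simp only [Pi.mul_apply, mul_one, ENNReal.one_rpow, lintegral_const, one_mul,
      Measure.restrict_apply_univ] at h2
    rw [← ENNReal.mul_rpow_of_nonneg _ _ (by norm_num)] at h2
    have h3 := ENNReal.rpow_le_rpow h2 (show (0:ℝ) ≤ 2 by norm_num)
    rw [← ENNReal.rpow_mul] at h3
    norm_num at h3
    unfold avgB
    rw [mul_pow]
    calc V⁻¹ ^ 2 * (∫⁻ z in closedBall x (2 * w), f z) ^ 2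
        ≤ V⁻¹ ^ 2 * ((∫⁻ z in closedBall x (2 * w), f z ^ 2) * V) := by gcongr
      _ = V⁻¹ * (V⁻¹ * V) * (∫⁻ z in closedBall x (2 * w), f z ^ 2) := by ring
      _ = V⁻¹ * (∫⁻ z in closedBall x (2 * w), f z ^ 2) := by
          rw [ENNReal.inv_mul_cancel hv0 hvt, mul_one]
      _ ≤ _ := by
          gcongr
          exact Measure.restrict_le_self
  have h4 : V⁻¹ ≤ ENNReal.ofReal (w ^ (-n : ℝ)) * (volume (ball (0 : Eu n) 1))⁻¹ := by
    rw [hV, vol_cb _ (by positivity), ENNReal.mul_inv (by left; simp; positivity) (by simp),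
      ← ENNReal.ofReal_inv_of_pos (by positivity)]
    gcongr
    rw [Real.rpow_neg hw.le, Real.rpow_natCast]
    gcongr
    linarith
  calc (avgB f (2 * w) x) ^ (2 / p) = ((avgB f (2 * w) x) ^ 2) ^ (1 / p) := by
        rw [← ENNReal.rpow_two, ← ENNReal.rpow_mul]; congr 1; ring
    _ ≤ (ENNReal.ofReal (w ^ (-n : ℝ)) *
        ((volume (ball (0 : Eu n) 1))⁻¹ * ∫⁻ z, f z ^ 2)) ^ (1 / p) := by
        apply ENNReal.rpow_le_rpow _ (by positivity)
        rw [← mul_assoc]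
        refine h1.trans ?_
        gcongr
    _ = _ := by
        rw [ENNReal.mul_rpow_of_nonneg _ _ (by positivity), ENNReal.ofReal_rpow_of_pos (by positivity),
          ← Real.rpow_mul hw.le]
        congr 3
        ring

lemma sub_average_le {α : Type*} [MeasurableSpace α] {μ : Measure α} [IsFiniteMeasure μ]
    (hμ : μ ≠ 0) {q : ℝ≥0∞} (hq : 1 ≤ q) {u : α → ℝ} (hu : Measurable u) (c : ℝ) :
    eLpNorm (fun x => u x - ⨍ y, u y ∂μ) q μ ≤ 2 * eLpNorm (fun x => u x - c) q μ := by
  by_cases ht : eLpNorm (fun x => u x - c) q μ = ⊤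
  · rw [ht]; simp
  have hm : AEStronglyMeasurable (fun x => u x - c) μ := (hu.sub_const c).aestronglyMeasurable
  have hmem : MemLp (fun x => u x - c) q μ := ⟨hm, lt_top_iff_ne_top.2 ht⟩
  have hint : Integrable (fun x => u x - c) μ := hmem.integrable hq
  have huint : Integrable u μ := by
    have := hint.add (integrable_const c)
    refine this.congr (Filter.Eventually.of_forall fun x => ?_)
    simp
  have hμ0 : μ univ ≠ 0 := by simpa using hμ
  have hμt : μ univ ≠ ⊤ := measure_ne_top _ _
  have : NeZero μ := ⟨hμ⟩
  have hav : ⨍ y, (u y - c) ∂μ = (⨍ y, u y ∂μ) - c := by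
    simp only [average_eq]
    rw [integral_sub huint (integrable_const c), smul_sub]
    congr 1
    rw [integral_const, smul_smul, inv_mul_cancel₀, one_smul]
    rw [Measure.real]
    exact (ENNReal.toReal_pos hμ0 hμt).ne'
  have e : (fun x => u x - ⨍ y, u y ∂μ) = (fun x => u x - c) - fun _ => ⨍ y, (u y - c) ∂μ := by
    funext x
    simp only [Pi.sub_apply]
    rw [hav]; ring
  have hq0 : q ≠ 0 := (lt_of_lt_of_le one_pos hq).ne'
  rw [e, two_mul]
  refine (eLpNorm_sub_le hm aestronglyMeasurable_const hq).trans ?_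
  gcongr
  rw [eLpNorm_const _ hq0 hμ]
  have h1 : ‖⨍ y, (u y - c) ∂μ‖ₑ ≤ (μ univ)⁻¹ * eLpNorm (fun x => u x - c) 1 μ := by
    rw [average_eq, enorm_smul, eLpNorm_one_eq_lintegral_enorm]
    gcongr
    · rw [Measure.real, Real.enorm_eq_ofReal (by positivity), ENNReal.ofReal_inv_of_pos
        (ENNReal.toReal_pos hμ0 hμt), ENNReal.ofReal_toReal hμt]
    · exact enorm_integral_le_lintegral_enorm _
  have h2 := eLpNorm_le_eLpNorm_mul_rpow_measure_univ hq hm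
  calc _ ≤ (μ univ)⁻¹ * (eLpNorm (fun x => u x - c) q μ *
        μ univ ^ (1 / (1 : ℝ≥0∞).toReal - 1 / q.toReal)) * μ univ ^ (1 / q.toReal) := by
        gcongr
        exact h1.trans (by gcongr)
    _ = eLpNorm (fun x => u x - c) q μ * ((μ univ)⁻¹ *
        (μ univ ^ (1 / (1 : ℝ≥0∞).toReal - 1 / q.toReal) * μ univ ^ (1 / q.toReal))) := by ring
    _ = _ := by
        rw [← ENNReal.rpow_add _ _ hμ0 hμt]
        simp [ENNReal.inv_mul_cancel hμ0 hμt]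

/-- Every John domain supports a `(pn/(n-ps), p)_s`-HSP imbedding for every
`s ∈ (0,1]` and `p ∈ (n/(n+s), n/s)`. -/
theorem stmt3 {n : ℕ} (hn : 2 ≤ n) (Ω : Set (Eu n)) (hΩ : IsDomainEu Ω)
    (hbd : Bornology.IsBounded Ω) (hJ : IsJohnDomain Ω) :
    ∀ s ∈ Set.Ioc (0:ℝ) 1, ∀ p : ℝ, (n : ℝ) / (n + s) < p → p < (n : ℝ) / s →
      SupportsHSP Ω s p := by
  intro s hs p hp1 hp2
  have hs0 : 0 < s := hs.1
  have hn0 : (0 : ℝ) < n := by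
    have : 0 < n := by omega
    exact_mod_cast this
  have hp : 0 < p := lt_trans (by positivity) hp1
  have hps : p * s < n := by rwa [lt_div_iff₀ hs0] at hp2
  have hnps : (0 : ℝ) < n - p * s := by linarith
  have hpn : (n : ℝ) - p * s < p * n := by
    rw [div_lt_iff₀ (by positivity)] at hp1; nlinarith
  have hopen : IsOpen Ω := hΩ.1
  have : Nontrivial (Eu n) := by
    have : Nonempty (Fin n) := ⟨⟨0, by omega⟩⟩
    infer_instance
  have hne : Ωᶜ.Nonempty := by
    rw [nonempty_compl]
    rintro rfl
    exact NormedSpace.unbounded_univ ℝ (Eu n) hbd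
  obtain ⟨x₀, hx₀, c, W, hc0, hc1, hW, hcurve⟩ := john_curve hopen hne hJ
  have hd0 : 0 < infDist x₀ Ωᶜ := by
    rw [← hopen.isClosed_compl.notMem_iff_infDist_pos hne]; simpa using hx₀
  have hl0 : 0 < 1 - c / 10 := by linarith
  have hl1 : 1 - c / 10 < 1 := by linarith
  set β := n / p - s with hβ
  have hβ0 : 0 < β := by
    rw [hβ, sub_pos, lt_div_iff₀ hp]; linarith
  obtain ⟨K, hK, hKb⟩ := series_bound W (1 - c / 10) s β hW hl0 hl1 hs0 hβ0
  set q := p * n / (n - p * s) with hq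
  have hq1 : 1 < q := by rw [hq, one_lt_div hnps]; exact hpn
  have hq0 : 0 < q := by linarith
  set a := s / (s + β) with ha
  set b := β / (s + β) with hb
  have hsβ : s + β = n / p := by rw [hβ]; ring
  have ha0 : 0 < a := by positivity
  have hb0 : 0 < b := by positivity
  have hab : a + b = 1 := by rw [ha, hb]; field_simp
  have hbq : 2 / p * b * q = 2 := by
    rw [hb, hsβ, hβ, hq]; field_simp
  have hexp : a / p + 1 / q = 1 / p := by
    rw [ha, hsβ, hq]; field_simp; ring
  set v := volume (ball (0 : Eu n) 1) with hv
  have hv0 : v ≠ 0 := (measure_ball_pos _ _ one_pos).ne'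
  have hvt : v ≠ ⊤ := measure_ball_lt_top.ne
  set C1 := ENNReal.ofReal ((20 / c) ^ n) with hC1
  set K2 : ℝ≥0∞ := 4 * C1 ^ (2 / p) with hK2
  have hK2t : K2 ≠ ⊤ := ENNReal.mul_ne_top (by simp)
    (ENNReal.rpow_ne_top_of_nonneg (by positivity) ENNReal.ofReal_ne_top)
  set Kf : ℝ≥0∞ := ENNReal.ofReal K * (K2 * (v⁻¹) ^ (a / p)) *
    (16 * ENNReal.ofReal (5 ^ n)) ^ (1 / q) with hKf
  have hKft : Kf ≠ ⊤ := by
    apply ENNReal.mul_ne_top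
    · apply ENNReal.mul_ne_top ENNReal.ofReal_ne_top
      apply ENNReal.mul_ne_top hK2t
      exact ENNReal.rpow_ne_top_of_nonneg (by positivity) (by simpa using hv0)
    · apply ENNReal.rpow_ne_top_of_nonneg (by positivity)
      exact ENNReal.mul_ne_top (by simp) ENNReal.ofReal_ne_top
  have hμfin : volume Ω < ⊤ := hbd.measure_lt_top
  have : IsFiniteMeasure (volume.restrict Ω) := isFiniteMeasure_restrict.2 hμfin.ne
  have hμ : volume.restrict Ω ≠ 0 := by
    rw [Ne, Measure.restrict_eq_zero]
    exact (hopen.measure_pos volume ⟨x₀, hx₀⟩).ne'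
  refine ⟨(2 * Kf).toReal + 1, by positivity, ?_⟩
  intro u hu
  have hmain : ∀ g ∈ DBall Ω s (1 / 2) u,
      eLpNorm (fun x => u x - ⨍ y in Ω, u y) (ENNReal.ofReal q) (volume.restrict Ω) ≤
        ENNReal.ofReal ((2 * Kf).toReal + 1) * eLpNorm g (ENNReal.ofReal p) (volume.restrict Ω) := by
    intro g hg
    obtain ⟨c₀, hc₀⟩ := chain_bound hopen hne hc0 hc1 hW hcurve hs hp u g hg
    have hgm := hg.1
    have hg0 := hg.2.1
    set f : Eu n → ℝ≥0∞ := Ω.indicator fun z => ENNReal.ofReal (g z) ^ (p / 2) with hf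
    have hfm : Measurable f := by
      apply Measurable.indicator _ hopen.measurableSet
      exact (ENNReal.measurable_ofReal.comp hgm).pow_const _
    set I := ∫⁻ z, f z ^ 2 with hI
    have hIg : I ^ (1 / p) = eLpNorm g (ENNReal.ofReal p) (volume.restrict Ω) := by
      rw [eLpNorm_eq_lintegral_rpow_enorm_toReal (by simpa using hp) ENNReal.ofReal_ne_top,
        ENNReal.toReal_ofReal hp.le, hI, ← lintegral_indicator hopen.measurableSet]
      congr 2
      funext z
      by_cases hz : z ∈ Ω
      · simp only [hf, indicator_of_mem hz]
        rw [Real.enorm_eq_ofReal (hg0 z), ← ENNReal.rpow_two, ← ENNReal.rpow_mul]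
        congr 1; ring
      · simp [hf, indicator_of_notMem hz]
    set M : Eu n → ℝ≥0∞ := fun x => ⨆ i : ℕ, avgB f (2 * (W * (1 - c / 10) ^ i)) x with hM
    have hwi : ∀ i : ℕ, 0 < W * (1 - c / 10) ^ i := fun i => by positivity
    have hML2 : ∫⁻ x, M x ^ 2 ≤ 16 * ENNReal.ofReal (5 ^ n) * I := by
      apply maximal_L2 f hfm _ (2 * W) (fun i => by have := hwi i; positivity)
      intro i
      have : (1 - c / 10) ^ i ≤ 1 := pow_le_one₀ hl0.le hl1.le
      nlinarith
    set Q := K2 * (v⁻¹ * I) ^ (1 / p) with hQ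
    have hpt : ∀ᵐ x ∂(volume.restrict Ω), ‖u x - c₀‖ₑ ≤
        ENNReal.ofReal K * (Q ^ a * (K2 * M x ^ (2 / p)) ^ b) := by
      filter_upwards [hc₀] with x hx
      rw [Real.enorm_eq_ofReal_abs]
      refine hx.trans (hKb _ _ _ ?_ ?_)
      · intro i
        rw [ENNReal.ofReal_mul (by norm_num), ENNReal.mul_rpow_of_nonneg _ _ (by positivity)]
        have : avgB f (2 * (W * (1 - c / 10) ^ i)) x ≤ M x :=
          le_iSup (fun i : ℕ => avgB f (2 * (W * (1 - c / 10) ^ i)) x) i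
        calc _ ≤ ENNReal.ofReal 4 * ENNReal.ofReal ((W * (1 - c / 10) ^ i) ^ s) *
              (C1 ^ (2 / p) * M x ^ (2 / p)) := by gcongr
          _ = _ := by
              rw [hK2, show ENNReal.ofReal 4 = 4 by simp]; ring
      · intro i
        rw [ENNReal.ofReal_mul (by norm_num), ENNReal.mul_rpow_of_nonneg _ _ (by positivity)]
        calc _ ≤ ENNReal.ofReal 4 * ENNReal.ofReal ((W * (1 - c / 10) ^ i) ^ s) *
              (C1 ^ (2 / p) * (ENNReal.ofReal ((W * (1 - c / 10) ^ i) ^ (-(n / p) : ℝ)) *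
                (v⁻¹ * I) ^ (1 / p))) := by
                gcongr
                exact avgB_holder hfm hp (hwi i) x
          _ = (ENNReal.ofReal ((W * (1 - c / 10) ^ i) ^ s) *
               ENNReal.ofReal ((W * (1 - c / 10) ^ i) ^ (-(n / p) : ℝ))) * Q := by
              rw [hQ, hK2, show ENNReal.ofReal 4 = 4 by simp]; ring
          _ = _ := by
              rw [← ENNReal.ofReal_mul (Real.rpow_nonneg (hwi i).le _), ← Real.rpow_add (hwi i)]
              congr 4
              rw [hβ]; ring
    have hc₀norm : eLpNorm (fun x => u x - c₀) (ENNReal.ofReal q) (volume.restrict Ω) ≤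
        Kf * I ^ (1 / p) := by
      rw [eLpNorm_eq_lintegral_rpow_enorm_toReal (by simpa using hq0) ENNReal.ofReal_ne_top,
        ENNReal.toReal_ofReal hq0.le]
      calc (∫⁻ x in Ω, ‖u x - c₀‖ₑ ^ q) ^ (1 / q)
          ≤ (∫⁻ x in Ω, (ENNReal.ofReal K * Q ^ a * K2 ^ b) ^ q * M x ^ 2) ^ (1 / q) := by
            apply ENNReal.rpow_le_rpow _ (by positivity)
            apply lintegral_mono_ae
            filter_upwards [hpt] with x hx
            refine (ENNReal.rpow_le_rpow hx hq0.le).trans (le_of_eq ?_)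
            rw [ENNReal.mul_rpow_of_nonneg K2 _ hb0.le, ← mul_assoc, ← mul_assoc,
              ENNReal.mul_rpow_of_nonneg _ _ hq0.le, ← ENNReal.rpow_mul, ← ENNReal.rpow_mul,
              ← mul_assoc (2 / p), hbq,
              ENNReal.rpow_two]
        _ ≤ ((ENNReal.ofReal K * Q ^ a * K2 ^ b) ^ q *
              (16 * ENNReal.ofReal (5 ^ n) * I)) ^ (1 / q) := by
            apply ENNReal.rpow_le_rpow _ (by positivity)
            have hMm : Measurable M := Measurable.iSup fun i =>
              avgB_meas hfm _ (by have := hwi i; positivity)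
            rw [lintegral_const_mul _ (hMm.pow_const 2)]
            gcongr
            exact (lintegral_mono' Measure.restrict_le_self le_rfl).trans hML2
        _ = ENNReal.ofReal K * Q ^ a * K2 ^ b *
              ((16 * ENNReal.ofReal (5 ^ n)) ^ (1 / q) * I ^ (1 / q)) := by
            rw [ENNReal.mul_rpow_of_nonneg _ _ (by positivity),
              ENNReal.mul_rpow_of_nonneg _ I (by positivity), ← ENNReal.rpow_mul,
              show q * (1 / q) = 1 by field_simp, ENNReal.rpow_one]
        _ = Kf * I ^ (1 / p) := by
            have e1 : Q ^ a = K2 ^ a * ((v⁻¹) ^ (a / p) * I ^ (a / p)) := by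
              rw [hQ, ENNReal.mul_rpow_of_nonneg _ _ ha0.le, ← ENNReal.rpow_mul,
                show 1 / p * a = a / p by ring, ENNReal.mul_rpow_of_nonneg (v⁻¹) I (by positivity)]
            have e2 : K2 = K2 ^ a * K2 ^ b := by
              rw [← ENNReal.rpow_add_of_nonneg _ _ ha0.le hb0.le, hab, ENNReal.rpow_one]
            have e3 : I ^ (1 / p) = I ^ (a / p) * I ^ (1 / q) := by
              rw [← ENNReal.rpow_add_of_nonneg _ _ (by positivity) (by positivity), hexp]
            rw [hKf, e1, e3]
            generalize hA : K2 ^ a = A at *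
            generalize hB : K2 ^ b = B at *
            rw [e2]
            ring
    calc _ ≤ 2 * eLpNorm (fun x => u x - c₀) (ENNReal.ofReal q) (volume.restrict Ω) :=
          sub_average_le hμ (by
            rw [← ENNReal.ofReal_one]; exact ENNReal.ofReal_le_ofReal hq1.le) hu.1 c₀
      _ ≤ 2 * (Kf * I ^ (1 / p)) := by gcongr
      _ = (2 * Kf) * eLpNorm g (ENNReal.ofReal p) (volume.restrict Ω) := by rw [hIg]; ring
      _ ≤ _ := by
          gcongr
          rw [← ENNReal.ofReal_toReal (ENNReal.mul_ne_top (by simp : (2:ℝ≥0∞) ≠ ⊤) hKft)]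
          apply ENNReal.ofReal_le_ofReal
          rw [ENNReal.ofReal_toReal (ENNReal.mul_ne_top (by simp : (2:ℝ≥0∞) ≠ ⊤) hKft)]
          linarith
  have hc0' : ENNReal.ofReal ((2 * Kf).toReal + 1) ≠ 0 := by
    simp only [ne_eq, ENNReal.ofReal_eq_zero, not_le]; positivity
  unfold ballNorm ballNormRho
  rw [mul_comm (ENNReal.ofReal ((2 * Kf).toReal + 1)),
    ← ENNReal.div_le_iff_le_mul (Or.inl hc0') (Or.inl ENNReal.ofReal_ne_top)]
  refine le_iInf₂ fun g hg => ?_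
  rw [ENNReal.div_le_iff_le_mul (Or.inl hc0') (Or.inl ENNReal.ofReal_ne_top),
    mul_comm (eLpNorm g _ _)]
  exact hmain g hg
end
end
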